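/- arXiv:2508.01657 — 5 statements merged into one kernel-verified Lean document; each statement's English description precedes it below -/
import Mathlib

section
/- Let d ∈ ℕ, 0 < α < d, and 1 ≤ p ≤ d/α. Then there exists a constant C = C(α, d, p) > 0, independent of θ, such that for every θ ∈ [0,1] and all nonnegative f ∈ L^{p,1}(ℝ^d) and g ∈ L^{d/α,1}(ℝ^d), one has ‖I_α^θ(f,g)‖_{L^{p,∞}(ℝ^d)} ≤ C ‖f‖_{L^{p,1}} ‖g‖_{L^{d/α,1}}. -/
open MeasureTheory Set
open scoped ENNReal NNReal

/-- The bilinear fractional integral operator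
`I_α^θ(f,g)(x) = ∫_{ℝ^d} f(x + (θ-1)y) g(x + θy) |y|^{α-d} dy`. -/
noncomputable def Ialpha (d : ℕ) (α θ : ℝ) (f g : EuclideanSpace ℝ (Fin d) → ℝ)
    (x : EuclideanSpace ℝ (Fin d)) : ℝ :=
  ∫ y : EuclideanSpace ℝ (Fin d), f (x + (θ - 1) • y) * g (x + θ • y) * ‖y‖ ^ (α - (d : ℝ))

/-- The weak Lebesgue `L^{r,∞}` quasinorm `‖h‖_{r,∞} = sup_{λ>0} λ |{x : |h(x)| > λ}|^{1/r}`. -/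
noncomputable def wnorm (r : ℝ) {d : ℕ} (h : EuclideanSpace ℝ (Fin d) → ℝ) : ℝ≥0∞ :=
  ⨆ (l : ℝ) (_ : 0 < l), ENNReal.ofReal l * volume {x | l < |h x|} ^ (1 / r)

/-- The decreasing rearrangement `h*` of a function `h`:
`h*(t) = inf {λ ≥ 0 : |{x : |h(x)| > λ}| ≤ t}`. -/
noncomputable def rearrangement {d : ℕ} (h : EuclideanSpace ℝ (Fin d) → ℝ) (t : ℝ) : ℝ≥0∞ :=
  sInf {l : ℝ≥0∞ | volume {x | l < ENNReal.ofReal |h x|} ≤ ENNReal.ofReal t}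

/-- The Lorentz `L^{p,1}` quasinorm `‖h‖_{p,1} = ∫_0^∞ t^{1/p} h*(t) dt/t`. -/
noncomputable def lorentzNorm (p : ℝ) {d : ℕ} (h : EuclideanSpace ℝ (Fin d) → ℝ) : ℝ≥0∞ :=
  ∫⁻ t in Set.Ioi (0 : ℝ), ENNReal.ofReal (t ^ (1 / p)) * rearrangement h t / ENNReal.ofReal t

/-- The Riesz potential measure `‖y‖ ^ (α - d) dy`. -/
noncomputable def rieszMeasure (d : ℕ) (α : ℝ) : Measure (EuclideanSpace ℝ (Fin d)) :=
  volume.withDensity fun y => ENNReal.ofReal (‖y‖ ^ (α - (d : ℝ)))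

instance (d : ℕ) (α : ℝ) : SFinite (rieszMeasure d α) := by
  unfold rieszMeasure; infer_instance

lemma measurable_rieszDensity (d : ℕ) (α : ℝ) :
    Measurable fun y : EuclideanSpace ℝ (Fin d) => ENNReal.ofReal (‖y‖ ^ (α - (d : ℝ))) := by
  fun_prop

lemma rieszMeasure_unitBall_lt_top {d : ℕ} (hd : 0 < d) {α : ℝ} (hα : 0 < α) :
    rieszMeasure d α (Metric.ball 0 1) < ⊤ := by
  have hint : IntegrableOn (fun y : EuclideanSpace ℝ (Fin d) => ‖y‖ ^ (α - (d : ℝ)))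
      (Metric.ball 0 1) volume := by
    refine integrableOn_ball_of_norm_le_rpow (C := 1) (α := (d : ℝ) - α) ?_ ?_ ?_ ?_
    · simpa using Nat.one_le_iff_ne_zero.2 hd.ne'
    · simpa using hα
    · refine Filter.Eventually.of_forall fun x => ?_
      rw [one_mul, neg_sub, Real.norm_of_nonneg (by positivity)]
    · exact Measurable.aestronglyMeasurable (by fun_prop)
  rw [rieszMeasure, withDensity_apply _ measurableSet_ball]
  have h := hint.hasFiniteIntegral
  simp only [HasFiniteIntegral, Real.enorm_eq_ofReal (Real.rpow_nonneg (norm_nonneg _) _)] at h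
  exact h

lemma rieszMeasure_ball {d : ℕ} (α : ℝ) {r : ℝ} (hr : 0 < r) :
    rieszMeasure d α (Metric.ball 0 r) =
      ENNReal.ofReal (r ^ α) * rieszMeasure d α (Metric.ball 0 1) := by
  have hpre : (fun y : EuclideanSpace ℝ (Fin d) => r • y) ⁻¹' Metric.ball 0 r =
      Metric.ball 0 1 := by
    ext y
    simp [norm_smul, abs_of_pos hr, hr]
  have hmap : ∫⁻ y in Metric.ball 0 r, ENNReal.ofReal (‖y‖ ^ (α - (d : ℝ)))
        ∂(Measure.map (fun y : EuclideanSpace ℝ (Fin d) => r • y) volume) =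
      ENNReal.ofReal (r ^ (α - (d : ℝ))) *
        ∫⁻ y : EuclideanSpace ℝ (Fin d) in Metric.ball 0 1,
          ENNReal.ofReal (‖y‖ ^ (α - (d : ℝ))) := by
    rw [setLIntegral_map measurableSet_ball (measurable_rieszDensity d α)
      (measurable_const_smul r), hpre, ← lintegral_const_mul _ (measurable_rieszDensity d α)]
    refine lintegral_congr fun y => ?_
    rw [← ENNReal.ofReal_mul (by positivity), norm_smul, Real.norm_of_nonneg hr.le,
      Real.mul_rpow hr.le (norm_nonneg y)]
  rw [Measure.map_addHaar_smul _ hr.ne', Measure.restrict_smul, lintegral_smul_measure,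
    finrank_euclideanSpace_fin, smul_eq_mul, abs_of_pos (by positivity)] at hmap
  rw [rieszMeasure, withDensity_apply _ measurableSet_ball, withDensity_apply _ measurableSet_ball]
  have hrd : ENNReal.ofReal (r ^ d) * ENNReal.ofReal ((r ^ d)⁻¹) = 1 := by
    rw [← ENNReal.ofReal_mul (by positivity), mul_inv_cancel₀ (by positivity), ENNReal.ofReal_one]
  rw [← one_mul (∫⁻ y in Metric.ball 0 r, _), ← hrd, mul_assoc, hmap, ← mul_assoc,
    ← ENNReal.ofReal_mul (by positivity), ← Real.rpow_natCast, ← Real.rpow_add hr]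
  simp

lemma rieszMeasure_le {d : ℕ} (hd : 0 < d) {α : ℝ} (hα : 0 < α) (hαd : α < d)
    {D : Set (EuclideanSpace ℝ (Fin d))} (hD : MeasurableSet D) :
    rieszMeasure d α D ≤
      (rieszMeasure d α (Metric.ball 0 1) + 1) * volume D ^ (α / d) := by
  have hd' : (0 : ℝ) < d := by exact_mod_cast hd
  have hpos : 0 < α / d := by positivity
  rcases eq_or_ne (volume D) ⊤ with htop | htop
  · rw [htop, ENNReal.top_rpow_of_pos hpos, ENNReal.mul_top (by simp)]
    exact le_top
  rcases eq_or_ne (volume D) 0 with h0 | h0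
  · have hac : rieszMeasure d α ≪ volume := withDensity_absolutelyContinuous _ _
    rw [hac h0]
    exact zero_le
  set v := (volume D).toReal with hv
  have hv0 : 0 < v := ENNReal.toReal_pos h0 htop
  have hvD : volume D = ENNReal.ofReal v := (ENNReal.ofReal_toReal htop).symm
  set r := v ^ (1 / (d : ℝ)) with hr
  have hr0 : 0 < r := by positivity
  have hrα : r ^ α = v ^ (α / d) := by
    rw [hr, ← Real.rpow_mul hv0.le]; congr 1; ring
  have hrαd : r ^ (α - d) * v = v ^ (α / d) := by
    rw [hr, ← Real.rpow_mul hv0.le, ← Real.rpow_add_one hv0.ne']; congr 1; field_simp; ring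
  have hout : rieszMeasure d α (D \ Metric.ball 0 r) ≤
      ENNReal.ofReal (r ^ (α - (d : ℝ))) * volume D := by
    rw [rieszMeasure, withDensity_apply _ (hD.diff measurableSet_ball)]
    calc _ ≤ ∫⁻ _ in D \ Metric.ball 0 r, ENNReal.ofReal (r ^ (α - (d : ℝ))) := by
            refine setLIntegral_mono measurable_const fun y hy => ENNReal.ofReal_le_ofReal ?_
            have hy' : r ≤ ‖y‖ := by simpa using hy.2
            exact Real.rpow_le_rpow_of_nonpos hr0 hy' (by linarith)
      _ ≤ _ := by
            rw [setLIntegral_const]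
            gcongr
            exact sdiff_subset
  calc rieszMeasure d α D ≤ rieszMeasure d α (Metric.ball 0 r ∪ D \ Metric.ball 0 r) :=
        measure_mono (by rw [union_sdiff_self]; exact subset_union_right)
    _ ≤ rieszMeasure d α (Metric.ball 0 r) + rieszMeasure d α (D \ Metric.ball 0 r) :=
        measure_union_le _ _
    _ ≤ ENNReal.ofReal (r ^ α) * rieszMeasure d α (Metric.ball 0 1) +
        ENNReal.ofReal (r ^ (α - (d : ℝ))) * volume D := by
        rw [rieszMeasure_ball α hr0]; gcongr
    _ = _ := by
        rw [hvD, ← ENNReal.ofReal_mul (by positivity), hrαd, hrα,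
          ENNReal.ofReal_rpow_of_pos hv0]
        ring

lemma volume_preimage_add_smul_le {d : ℕ} {c : ℝ} (hc : 1 / 2 ≤ |c|)
    (x : EuclideanSpace ℝ (Fin d)) (B : Set (EuclideanSpace ℝ (Fin d))) :
    volume {y | x + c • y ∈ B} ≤ 2 ^ d * volume B := by
  have hc0 : c ≠ 0 := by rintro rfl; norm_num at hc
  have : {y | x + c • y ∈ B} = (c • ·) ⁻¹' ((x + ·) ⁻¹' B) := rfl
  rw [this, Measure.addHaar_preimage_smul _ hc0, measure_preimage_add,
    finrank_euclideanSpace_fin]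
  gcongr
  rw [abs_inv, abs_pow, ← inv_pow, ENNReal.ofReal_pow (by positivity)]
  gcongr
  rw [← ENNReal.ofReal_ofNat]
  refine ENNReal.ofReal_le_ofReal ?_
  rw [inv_le_comm₀ (by positivity) (by norm_num)]
  linarith

/-- Fixing the point where `A` is evaluated and integrating in `y` first. -/
lemma prod_rieszMeasure_le {d : ℕ} (hd : 0 < d) {α : ℝ} (hα : 0 < α) (hαd : α < d)
    {c₁ c₂ : ℝ} (hc : 1 / 2 ≤ |c₂ - c₁|)
    {A B : Set (EuclideanSpace ℝ (Fin d))} (hA : MeasurableSet A) (hB : MeasurableSet B) :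
    ((volume : Measure (EuclideanSpace ℝ (Fin d))).prod (rieszMeasure d α))
        {z | z.1 + c₁ • z.2 ∈ A ∧ z.1 + c₂ • z.2 ∈ B} ≤
      (rieszMeasure d α (Metric.ball 0 1) + 1) * (2 ^ d) ^ (α / d) *
        (volume A * volume B ^ (α / d)) := by
  have hmeas : ∀ a b : ℝ, MeasurableSet
      {z : EuclideanSpace ℝ (Fin d) × EuclideanSpace ℝ (Fin d) |
        z.1 + a • z.2 ∈ A ∧ z.1 + b • z.2 ∈ B} := fun a b =>
    (hA.preimage (by fun_prop : Measurable fun z : EuclideanSpace ℝ (Fin d) ×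
      EuclideanSpace ℝ (Fin d) => z.1 + a • z.2)).inter
    (hB.preimage (by fun_prop : Measurable fun z : EuclideanSpace ℝ (Fin d) ×
      EuclideanSpace ℝ (Fin d) => z.1 + b • z.2))
  have hshift : ((volume : Measure (EuclideanSpace ℝ (Fin d))).prod (rieszMeasure d α))
        {z | z.1 + c₁ • z.2 ∈ A ∧ z.1 + c₂ • z.2 ∈ B} =
      ((volume : Measure (EuclideanSpace ℝ (Fin d))).prod (rieszMeasure d α))
        {z | z.1 + (0 : ℝ) • z.2 ∈ A ∧ z.1 + (c₂ - c₁) • z.2 ∈ B} := by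
    rw [Measure.prod_apply_symm (hmeas _ _), Measure.prod_apply_symm (hmeas _ _)]
    refine lintegral_congr fun y => ?_
    rw [eq_comm, ← measure_preimage_add_right volume (c₁ • y)]
    congr 1
    ext x
    have : x + c₂ • y = x + c₁ • y + (c₂ - c₁) • y := by module
    simp only [mem_preimage, mem_ofPred_eq, zero_smul, add_zero, this]
  have hβ : 0 ≤ α / d := by positivity
  rw [hshift, Measure.prod_apply (hmeas _ _)]
  calc _ ≤ ∫⁻ x, A.indicator (fun _ => (rieszMeasure d α (Metric.ball 0 1) + 1) *
            (2 ^ d * volume B) ^ (α / d)) x := by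
        refine lintegral_mono fun x => ?_
        by_cases hx : x ∈ A
        · have hBx : MeasurableSet {y | x + (c₂ - c₁) • y ∈ B} :=
            hB.preimage (by fun_prop : Measurable fun y => x + (c₂ - c₁) • y)
          simp only [preimage_ofPred_eq, zero_smul, add_zero, hx, true_and, indicator_of_mem]
          refine (rieszMeasure_le hd hα hαd hBx).trans ?_
          gcongr
          exact volume_preimage_add_smul_le hc x B
        · simp [hx]
    _ = _ := by
        rw [lintegral_indicator hA, setLIntegral_const, ENNReal.mul_rpow_of_nonneg _ _ hβ]
        ring

lemma ENNReal.le_mul_rpow_of_le_of_le_of_le {t K X Y Z : ℝ≥0∞} {u v w : ℝ} (hu : 0 ≤ u)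
    (hv : 0 ≤ v) (hw : 0 ≤ w) (huvw : u + v + w = 1)
    (hX : t ≤ K * X) (hY : t ≤ K * Y) (hZ : t ≤ K * Z) :
    t ≤ K * (X ^ u * Y ^ v * Z ^ w) := by
  have hsplit : ∀ s : ℝ≥0∞, s = s ^ u * s ^ v * s ^ w := fun s => by
    rw [← ENNReal.rpow_add_of_nonneg _ _ hu hv,
      ← ENNReal.rpow_add_of_nonneg _ _ (by positivity) hw, huvw, ENNReal.rpow_one]
  calc t = t ^ u * t ^ v * t ^ w := hsplit t
    _ ≤ (K * X) ^ u * (K * Y) ^ v * (K * Z) ^ w := by gcongr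
    _ = (K ^ u * K ^ v * K ^ w) * (X ^ u * Y ^ v * Z ^ w) := by
        rw [ENNReal.mul_rpow_of_nonneg _ _ hu, ENNReal.mul_rpow_of_nonneg _ _ hv,
          ENNReal.mul_rpow_of_nonneg _ _ hw]
        ring
    _ = _ := by rw [← hsplit K]

lemma ENNReal.le_mul_rpow_mul_rpow_of_vertex_bounds {t K a b e : ℝ≥0∞} {β q : ℝ} (hβ0 : 0 ≤ β)
    (hβ1 : β < 1) (hβq : β ≤ q) (hq1 : q ≤ 1) (h₁ : t ≤ K * (a * b ^ β))
    (h₂ : t ≤ K * (e * b ^ β) ∨ t ≤ K * (b * a ^ β) ∧ t ≤ K * (e * a ^ β)) :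
    t ≤ K * (e ^ (1 - q) * a ^ q * b ^ β) := by
  have hq0 : 0 ≤ q := hβ0.trans hβq
  have hr0 : 0 ≤ 1 - q := by linarith
  rcases h₂ with h₂ | ⟨h₂, h₃⟩
  · refine (ENNReal.le_mul_rpow_of_le_of_le_of_le hq0 hr0 le_rfl (by ring) h₁ h₂ h₂).trans_eq ?_
    have hb : b ^ β = b ^ (β * q) * b ^ (β * (1 - q)) := by
      rw [← ENNReal.rpow_add_of_nonneg _ _ (by positivity) (by positivity)]; congr 1; ring
    rw [ENNReal.mul_rpow_of_nonneg _ _ hq0, ENNReal.mul_rpow_of_nonneg _ _ hr0,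
      ← ENNReal.rpow_mul, ← ENNReal.rpow_mul, hb, ENNReal.rpow_zero]
    ring
  · have hβ1' : 0 < 1 - β := by linarith
    obtain ⟨u, hu⟩ : ∃ u, u = (q - β) / (1 - β) := ⟨_, rfl⟩
    obtain ⟨v, hv⟩ : ∃ v, v = β * (1 - q) / (1 - β) := ⟨_, rfl⟩
    have hu0 : 0 ≤ u := hu ▸ div_nonneg (by linarith) hβ1'.le
    have hv0 : 0 ≤ v := hv ▸ div_nonneg (by positivity) hβ1'.le
    have huv : u + v = q := by rw [hu, hv]; field_simp; ring
    have huvβ : β * u + v = β := by rw [hu, hv]; field_simp; ring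
    refine (ENNReal.le_mul_rpow_of_le_of_le_of_le hu0 hv0 hr0 (by linarith) h₁ h₂ h₃).trans_eq ?_
    have hb : b ^ β = b ^ (β * u) * b ^ v := by
      rw [← ENNReal.rpow_add_of_nonneg _ _ (by positivity) (by positivity), huvβ]
    have ha : a ^ q = a ^ u * a ^ (β * v) * a ^ (β * (1 - q)) := by
      rw [← ENNReal.rpow_add_of_nonneg _ _ (by positivity) (by positivity),
        ← ENNReal.rpow_add_of_nonneg _ _ (by positivity) (by positivity)]
      congr 1
      linear_combination (-1 - β) * huv + huvβ
    rw [ENNReal.mul_rpow_of_nonneg _ _ hu0, ENNReal.mul_rpow_of_nonneg _ _ hv0,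
      ENNReal.mul_rpow_of_nonneg _ _ hr0, ← ENNReal.rpow_mul, ← ENNReal.rpow_mul,
      ← ENNReal.rpow_mul, hb, ha]
    ring

/-- The restricted estimate: the trilinear form on indicator functions. -/
lemma prod_rieszMeasure_trilinear_le {d : ℕ} (hd : 0 < d) {α p : ℝ} (hα : 0 < α) (hαd : α < d)
    (hp : 1 ≤ p) (hpd : p ≤ d / α) (θ : ℝ)
    {D A B : Set (EuclideanSpace ℝ (Fin d))} (hD : MeasurableSet D) (hA : MeasurableSet A)
    (hB : MeasurableSet B) :
    ((volume : Measure (EuclideanSpace ℝ (Fin d))).prod (rieszMeasure d α))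
        {z | z.1 ∈ D ∧ z.1 + (θ - 1) • z.2 ∈ A ∧ z.1 + θ • z.2 ∈ B} ≤
      (rieszMeasure d α (Metric.ball 0 1) + 1) * (2 ^ d) ^ (α / d) *
        (volume D ^ (1 - 1 / p) * volume A ^ (1 / p) * volume B ^ (α / d)) := by
  have hd' : (0 : ℝ) < d := by exact_mod_cast hd
  have hp0 : 0 < p := by linarith
  have hβ0 : 0 ≤ α / d := by positivity
  have hβ1 : α / d < 1 := (div_lt_one hd').2 hαd
  have hq1 : 1 / p ≤ 1 := (div_le_one hp0).2 hp
  have hq0 : 0 ≤ 1 / p := by positivity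
  have hβq : α / d ≤ 1 / p := by
    rw [div_le_div_iff₀ hd' hp0]
    rw [le_div_iff₀ hα] at hpd
    linarith
  have hmono : ∀ {S T : Set (EuclideanSpace ℝ (Fin d) × EuclideanSpace ℝ (Fin d))} {M : ℝ≥0∞},
      (volume.prod (rieszMeasure d α)) T ≤ M → S ⊆ T → (volume.prod (rieszMeasure d α)) S ≤ M :=
    fun hT hST => (measure_mono hST).trans hT
  refine ENNReal.le_mul_rpow_mul_rpow_of_vertex_bounds hβ0 hβ1 hβq hq1 ?_ ?_
  · exact hmono (prod_rieszMeasure_le hd hα hαd (c₁ := θ - 1) (c₂ := θ) (by norm_num) hA hB)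
      fun z hz => hz.2
  rcases le_total (1 / 2) θ with hθ | hθ
  · left
    exact hmono (prod_rieszMeasure_le hd hα hαd (c₁ := 0) (c₂ := θ)
      (by rw [sub_zero]; exact hθ.trans (le_abs_self θ)) hD hB)
      fun z hz => ⟨by simpa using hz.1, hz.2.2⟩
  · right
    constructor
    · exact hmono (prod_rieszMeasure_le hd hα hαd (c₁ := θ) (c₂ := θ - 1) (by norm_num) hB hA)
        fun z hz => ⟨hz.2.2, hz.2.1⟩
    · exact hmono (prod_rieszMeasure_le hd hα hαd (c₁ := 0) (c₂ := θ - 1)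
        (by rw [sub_zero, abs_sub_comm]; exact le_trans (by linarith) (le_abs_self _)) hD hA)
        fun z hz => ⟨by simpa using hz.1, hz.2.1⟩

lemma ofReal_rpow_eq_lintegral_Ioo {q v : ℝ} (hq : 0 < q) (hv : 0 ≤ v) :
    ENNReal.ofReal (v ^ q) = ∫⁻ t in Ioo 0 v, ENNReal.ofReal (q * t ^ (q - 1)) := by
  have hint : IntervalIntegrable (fun t : ℝ => q * t ^ (q - 1)) volume 0 v :=
    (intervalIntegral.intervalIntegrable_rpow' (by linarith)).const_mul q
  have hval : ∫ t in (0 : ℝ)..v, q * t ^ (q - 1) = v ^ q := by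
    rw [intervalIntegral.integral_const_mul, integral_rpow (Or.inl (by linarith)),
      sub_add_cancel, Real.zero_rpow hq.ne']
    field_simp
    ring
  rw [← hval, intervalIntegral.integral_of_le hv,
    ofReal_integral_eq_lintegral_ofReal hint.1, setLIntegral_congr Ioo_ae_eq_Ioc]
  filter_upwards [ae_restrict_mem measurableSet_Ioc] with t ht
  have := ht.1
  positivity

lemma ENNReal.rpow_le_lintegral_indicator {q : ℝ} (hq : 0 < q) (m : ℝ≥0∞) :
    m ^ q ≤ ∫⁻ t in Ioi (0 : ℝ),
      {t : ℝ | ENNReal.ofReal t < m}.indicator (fun t => ENNReal.ofReal (q * t ^ (q - 1))) t := by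
  rw [← ENNReal.le_rpow_inv_iff hq]
  refine ENNReal.le_of_forall_nnreal_lt fun r hr => ?_
  have hr0 : (0 : ℝ) ≤ r := r.2
  rw [ENNReal.le_rpow_inv_iff hq, ← ENNReal.ofReal_coe_nnreal,
    ENNReal.ofReal_rpow_of_nonneg hr0 hq.le, ofReal_rpow_eq_lintegral_Ioo hq hr0,
    ← lintegral_indicator measurableSet_Ioo, ← lintegral_indicator measurableSet_Ioi]
  refine lintegral_mono fun t => ?_
  by_cases ht : t ∈ Ioo (0 : ℝ) r
  · have htm : ENNReal.ofReal t < m := by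
      refine lt_of_le_of_lt ?_ hr
      rw [← ENNReal.ofReal_coe_nnreal]
      exact ENNReal.ofReal_le_ofReal ht.2.le
    rw [indicator_of_mem ht, indicator_of_mem (show t ∈ Ioi (0 : ℝ) from ht.1),
      indicator_of_mem (show t ∈ {t : ℝ | ENNReal.ofReal t < m} from htm)]
  · rw [indicator_of_notMem ht]
    exact zero_le

lemma ofReal_le_rearrangement {d : ℕ} {f : EuclideanSpace ℝ (Fin d) → ℝ} {s t : ℝ}
    (h : ENNReal.ofReal t < volume {x | s < f x}) : ENNReal.ofReal s ≤ rearrangement f t := by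
  refine le_sInf fun l hl => ?_
  by_contra! hls
  refine absurd (h.trans_le ((measure_mono fun x hx => ?_).trans hl)) (lt_irrefl _)
  have hx' : s < f x := hx
  exact hls.trans_le (ENNReal.ofReal_le_ofReal (hx'.le.trans (le_abs_self _)))

lemma measurable_distribution {d : ℕ} (f : EuclideanSpace ℝ (Fin d) → ℝ) :
    Measurable fun s : ℝ => volume {x | s < f x} :=
  Antitone.measurable fun _ _ hs => measure_mono fun _ hx => lt_of_le_of_lt hs hx

/-- The distributional form of the Lorentz quasinorm is controlled by the rearrangement form. -/
lemma lintegral_distribution_rpow_le_lorentzNorm {d : ℕ} {p : ℝ} (hp : 1 ≤ p)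
    (f : EuclideanSpace ℝ (Fin d) → ℝ) :
    ∫⁻ s in Ioi (0 : ℝ), volume {x | s < f x} ^ (1 / p) ≤ lorentzNorm p f := by
  have hp0 : 0 < p := by linarith
  have hq0 : 0 < 1 / p := by positivity
  have hq1 : 1 / p ≤ 1 := (div_le_one hp0).2 hp
  have hset : MeasurableSet {z : ℝ × ℝ | ENNReal.ofReal z.2 < volume {x | z.1 < f x}} :=
    measurableSet_lt (by fun_prop) ((measurable_distribution f).comp measurable_fst)
  calc ∫⁻ s in Ioi (0 : ℝ), volume {x | s < f x} ^ (1 / p)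
      ≤ ∫⁻ s in Ioi (0 : ℝ), ∫⁻ t in Ioi (0 : ℝ),
          {t : ℝ | ENNReal.ofReal t < volume {x | s < f x}}.indicator
            (fun t => ENNReal.ofReal (1 / p * t ^ (1 / p - 1))) t :=
        lintegral_mono fun s => ENNReal.rpow_le_lintegral_indicator hq0 _
    _ = ∫⁻ t in Ioi (0 : ℝ), ∫⁻ s in Ioi (0 : ℝ),
          {t : ℝ | ENNReal.ofReal t < volume {x | s < f x}}.indicator
            (fun t => ENNReal.ofReal (1 / p * t ^ (1 / p - 1))) t := by
        refine lintegral_lintegral_swap (Measurable.aemeasurable ?_)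
        exact Measurable.indicator (f := fun z : ℝ × ℝ =>
          ENNReal.ofReal (1 / p * z.2 ^ (1 / p - 1))) (by fun_prop) hset
    _ ≤ lorentzNorm p f := by
        refine setLIntegral_mono' measurableSet_Ioi fun t (ht : 0 < t) => ?_
        calc _ ≤ ∫⁻ s in Ioi (0 : ℝ), {s : ℝ | ENNReal.ofReal s ≤ rearrangement f t}.indicator
                (fun _ => ENNReal.ofReal (t ^ (1 / p)) / ENNReal.ofReal t) s := by
              refine setLIntegral_mono' measurableSet_Ioi fun s _ => ?_
              by_cases h : ENNReal.ofReal t < volume {x | s < f x}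
              · rw [indicator_of_mem (show t ∈ {t : ℝ | ENNReal.ofReal t < volume {x | s < f x}} from h), indicator_of_mem
                  (show s ∈ {s : ℝ | ENNReal.ofReal s ≤ rearrangement f t} from ofReal_le_rearrangement h),
                  ← ENNReal.ofReal_div_of_pos ht]
                refine ENNReal.ofReal_le_ofReal ?_
                rw [Real.rpow_sub_one ht.ne']
                exact mul_le_of_le_one_left (by positivity) hq1
              · rw [indicator_of_notMem (show t ∉ {t : ℝ | ENNReal.ofReal t < volume {x | s < f x}} from h)]
                exact zero_le
          _ = ENNReal.ofReal (t ^ (1 / p)) / ENNReal.ofReal t *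
                (volume.restrict (Ioi 0)) {s : ℝ | ENNReal.ofReal s ≤ rearrangement f t} := by
              rw [lintegral_indicator_const (measurableSet_le (by fun_prop) measurable_const)]
          _ ≤ ENNReal.ofReal (t ^ (1 / p)) / ENNReal.ofReal t * rearrangement f t := by
              gcongr
              rcases eq_or_ne (rearrangement f t) ⊤ with htop | htop
              · rw [htop]; exact le_top
              rw [Measure.restrict_apply (measurableSet_le (by fun_prop) measurable_const)]
              calc _ ≤ volume (Icc 0 (rearrangement f t).toReal) := by
                    refine measure_mono fun s hs => ⟨le_of_lt hs.2, ?_⟩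
                    exact (ENNReal.ofReal_le_iff_le_toReal htop).1 hs.1
                _ = _ := by rw [Real.volume_Icc, sub_zero, ENNReal.ofReal_toReal htop]
          _ = _ := by simp only [div_eq_mul_inv]; ring

/-- Applying the layer cake formula to both factors of a product. -/
lemma lintegral_ofReal_mul_ofReal_le {X : Type*} [MeasurableSpace X] {ν : Measure X}
    {F G : X → ℝ} (hF : Measurable F) (hG : Measurable G) (hF0 : 0 ≤ F) (hG0 : 0 ≤ G)
    {M : ℝ≥0∞} {a b : ℝ → ℝ≥0∞} (ha : Measurable a) (hb : Measurable b)
    (h : ∀ s t, ν {z | s < F z ∧ t < G z} ≤ M * (a s * b t)) :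
    ∫⁻ z, ENNReal.ofReal (F z) * ENNReal.ofReal (G z) ∂ν ≤
      M * ((∫⁻ s in Ioi (0 : ℝ), a s) * ∫⁻ t in Ioi (0 : ℝ), b t) := by
  have hGm : Measurable fun z => ENNReal.ofReal (G z) := by fun_prop
  have hFm : Measurable fun z => ENNReal.ofReal (F z) := by fun_prop
  have hlevel : ∀ s, (ν.withDensity fun z => ENNReal.ofReal (G z)) {z | s < F z} ≤
      M * (a s * ∫⁻ t in Ioi (0 : ℝ), b t) := fun s => by
    have hs : MeasurableSet {z | s < F z} := measurableSet_lt measurable_const hF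
    rw [withDensity_apply _ hs, lintegral_eq_lintegral_meas_lt _
      (Filter.Eventually.of_forall hG0) hG.aemeasurable, ← lintegral_const_mul _ hb,
      ← lintegral_const_mul _ (hb.const_mul _)]
    refine lintegral_mono fun t => ?_
    rw [Measure.restrict_apply (measurableSet_lt measurable_const hG), inter_comm]
    exact h s t
  calc ∫⁻ z, ENNReal.ofReal (F z) * ENNReal.ofReal (G z) ∂ν
      = ∫⁻ z, ENNReal.ofReal (F z) ∂(ν.withDensity fun z => ENNReal.ofReal (G z)) := by
        rw [lintegral_withDensity_eq_lintegral_mul _ hGm hFm]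
        simp only [Pi.mul_apply, mul_comm]
    _ = ∫⁻ s in Ioi (0 : ℝ), (ν.withDensity fun z => ENNReal.ofReal (G z)) {z | s < F z} :=
        lintegral_eq_lintegral_meas_lt _ (Filter.Eventually.of_forall hF0) hF.aemeasurable
    _ ≤ ∫⁻ s in Ioi (0 : ℝ), M * (a s * ∫⁻ t in Ioi (0 : ℝ), b t) := lintegral_mono hlevel
    _ = _ := by rw [lintegral_const_mul _ (ha.mul_const _), lintegral_mul_const _ ha]

/-- The bilinear fractional integral with values in `ℝ≥0∞`. -/
noncomputable def lIalpha (d : ℕ) (α θ : ℝ) (f g : EuclideanSpace ℝ (Fin d) → ℝ)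
    (x : EuclideanSpace ℝ (Fin d)) : ℝ≥0∞ :=
  ∫⁻ y, ENNReal.ofReal (f (x + (θ - 1) • y)) * ENNReal.ofReal (g (x + θ • y)) ∂rieszMeasure d α

section
variable {d : ℕ} {α θ : ℝ} {f g : EuclideanSpace ℝ (Fin d) → ℝ}

lemma measurable_lIalpha_integrand (hf : Measurable f) (hg : Measurable g) :
    Measurable fun z : EuclideanSpace ℝ (Fin d) × EuclideanSpace ℝ (Fin d) =>
      ENNReal.ofReal (f (z.1 + (θ - 1) • z.2)) * ENNReal.ofReal (g (z.1 + θ • z.2)) := by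
  fun_prop

lemma measurable_lIalpha (hf : Measurable f) (hg : Measurable g) :
    Measurable (lIalpha d α θ f g) :=
  (measurable_lIalpha_integrand hf hg).lintegral_prod_right'

lemma ofReal_abs_Ialpha_le (hf : Measurable f) (hg : Measurable g) (hf0 : 0 ≤ f) (hg0 : 0 ≤ g)
    (x : EuclideanSpace ℝ (Fin d)) :
    ENNReal.ofReal |Ialpha d α θ f g x| ≤ lIalpha d α θ f g x := by
  have hm : Measurable fun y => ENNReal.ofReal (f (x + (θ - 1) • y)) *
      ENNReal.ofReal (g (x + θ • y)) := by fun_prop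
  rw [← Real.norm_eq_abs, ofReal_norm, lIalpha, rieszMeasure,
    lintegral_withDensity_eq_lintegral_mul _ (measurable_rieszDensity d α) hm]
  refine (enorm_integral_le_lintegral_enorm _).trans_eq (lintegral_congr fun y => ?_)
  have h1 := hf0 (x + (θ - 1) • y)
  have h2 := hg0 (x + θ • y)
  rw [Real.enorm_eq_ofReal (mul_nonneg (mul_nonneg h1 h2) (by positivity)),
    ENNReal.ofReal_mul (mul_nonneg h1 h2), ENNReal.ofReal_mul h1, Pi.mul_apply, mul_comm]

lemma setLIntegral_lIalpha_le {p : ℝ} (hd : 0 < d) (hα : 0 < α) (hαd : α < d)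
    (hp : 1 ≤ p) (hpd : p ≤ d / α) (hf : Measurable f) (hg : Measurable g)
    (hf0 : 0 ≤ f) (hg0 : 0 ≤ g) {D : Set (EuclideanSpace ℝ (Fin d))} (hD : MeasurableSet D) :
    ∫⁻ x in D, lIalpha d α θ f g x ≤
      (rieszMeasure d α (Metric.ball 0 1) + 1) * (2 ^ d) ^ (α / d) * volume D ^ (1 - 1 / p) *
        (lorentzNorm p f * lorentzNorm (d / α) g) := by
  have hfm : Measurable fun z : EuclideanSpace ℝ (Fin d) × EuclideanSpace ℝ (Fin d) =>
      f (z.1 + (θ - 1) • z.2) := by fun_prop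
  have hgm : Measurable fun z : EuclideanSpace ℝ (Fin d) × EuclideanSpace ℝ (Fin d) =>
      g (z.1 + θ • z.2) := by fun_prop
  calc ∫⁻ x in D, lIalpha d α θ f g x
      = ∫⁻ z, ENNReal.ofReal (f (z.1 + (θ - 1) • z.2)) * ENNReal.ofReal (g (z.1 + θ • z.2))
          ∂((volume.restrict D).prod (rieszMeasure d α)) :=
        (lintegral_prod _ (measurable_lIalpha_integrand hf hg).aemeasurable).symm
    _ ≤ (rieszMeasure d α (Metric.ball 0 1) + 1) * (2 ^ d) ^ (α / d) * volume D ^ (1 - 1 / p) *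
          ((∫⁻ s in Ioi (0 : ℝ), volume {x | s < f x} ^ (1 / p)) *
            ∫⁻ t in Ioi (0 : ℝ), volume {x | t < g x} ^ (1 / (d / α))) := by
        refine lintegral_ofReal_mul_ofReal_le hfm hgm (fun z => hf0 _) (fun z => hg0 _)
          ((measurable_distribution f).pow_const _) ((measurable_distribution g).pow_const _) fun s t => ?_
        have hset : MeasurableSet {z : EuclideanSpace ℝ (Fin d) × EuclideanSpace ℝ (Fin d) |
            s < f (z.1 + (θ - 1) • z.2) ∧ t < g (z.1 + θ • z.2)} :=
          (measurableSet_lt measurable_const hfm).inter (measurableSet_lt measurable_const hgm)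
        have hres : (volume.restrict D).prod (rieszMeasure d α) =
            (volume.prod (rieszMeasure d α)).restrict (D ×ˢ univ) := by
          rw [← Measure.prod_restrict, Measure.restrict_univ]
        have hset' : {z : EuclideanSpace ℝ (Fin d) × EuclideanSpace ℝ (Fin d) |
            s < f (z.1 + (θ - 1) • z.2) ∧ t < g (z.1 + θ • z.2)} ∩ D ×ˢ univ =
            {z | z.1 ∈ D ∧ z.1 + (θ - 1) • z.2 ∈ {x | s < f x} ∧
              z.1 + θ • z.2 ∈ {x | t < g x}} := by
          ext z
          simp only [mem_inter_iff, mem_ofPred_eq, mem_prod, mem_univ, and_true]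
          tauto
        rw [hres, Measure.restrict_apply hset, hset']
        refine (prod_rieszMeasure_trilinear_le hd hα hαd hp hpd θ hD
          (measurableSet_lt measurable_const hf) (measurableSet_lt measurable_const hg)).trans_eq ?_
        rw [one_div_div]
        ring
    _ ≤ _ := by
        gcongr
        · exact lintegral_distribution_rpow_le_lorentzNorm hp f
        · exact lintegral_distribution_rpow_le_lorentzNorm (hp.trans hpd) g

end

/-- An estimate for averages over sets of finite measure gives a weak-type bound. -/
lemma mul_measure_rpow_le_of_setLIntegral_le {X : Type*} [MeasurableSpace X] {μ : Measure X}
    [SigmaFinite μ] {h : X → ℝ≥0∞} (hh : Measurable h) {q : ℝ} (hq : 0 < q) {M l : ℝ≥0∞}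
    (hM : ∀ D, MeasurableSet D → ∫⁻ x in D, h x ∂μ ≤ M * μ D ^ (1 - q)) (hl : l ≠ 0) (hl' : l ≠ ⊤) :
    l * μ {x | l < h x} ^ q ≤ M := by
  rw [mul_comm, ← ENNReal.le_div_iff_mul_le (Or.inl hl) (Or.inl hl'), ← ENNReal.le_rpow_inv_iff hq]
  refine le_of_forall_lt fun r hr => ?_
  obtain ⟨D, hD, hDs, hrD, hDtop⟩ :=
    Measure.exists_subset_measure_lt_top (measurableSet_lt measurable_const hh) hr
  refine hrD.trans_le ?_
  rw [ENNReal.le_rpow_inv_iff hq, ENNReal.le_div_iff_mul_le (Or.inl hl) (Or.inl hl')]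
  have hD0 : μ D ≠ 0 := (zero_le.trans_lt hrD).ne'
  have hlD : l * μ D ≤ M * μ D ^ (1 - q) :=
    calc l * μ D = ∫⁻ _ in D, l ∂μ := by rw [setLIntegral_const]
      _ ≤ ∫⁻ x in D, h x ∂μ := setLIntegral_mono hh fun x hx => le_of_lt (hDs hx)
      _ ≤ _ := hM D hD
  rw [← ENNReal.mul_le_mul_iff_left (c := μ D ^ (1 - q))
    (by simp [ENNReal.rpow_eq_zero_iff, hD0, hDtop.ne])
    (by simp [ENNReal.rpow_eq_top_iff, hD0, hDtop.ne])]
  calc μ D ^ q * l * μ D ^ (1 - q) = l * (μ D ^ q * μ D ^ (1 - q)) := by ring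
    _ = l * μ D := by rw [← ENNReal.rpow_add _ _ hD0 hDtop.ne]; simp
    _ ≤ _ := hlD

/-- Fully uniform weak-type bound on the lower edge for Lorentz data:
`L^{p,1} × L^{d/α,1} → L^{p,∞}` for `1 ≤ p ≤ d/α`, uniformly in `θ ∈ [0,1]`. -/
theorem lorentz_bound_floor (d : ℕ) (hd : 0 < d) (α p : ℝ)
    (hα : 0 < α) (hαd : α < d) (hp : 1 ≤ p) (hpd : p ≤ d / α) :
    ∃ C : ℝ, 0 < C ∧ ∀ θ : ℝ, θ ∈ Set.Icc (0 : ℝ) 1 →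
      ∀ f g : EuclideanSpace ℝ (Fin d) → ℝ, Measurable f → Measurable g →
        0 ≤ f → 0 ≤ g → lorentzNorm p f < ⊤ → lorentzNorm (d / α) g < ⊤ →
        wnorm p (Ialpha d α θ f g) ≤
          ENNReal.ofReal C * lorentzNorm p f * lorentzNorm (d / α) g := by
  set K : ℝ≥0∞ := (rieszMeasure d α (Metric.ball 0 1) + 1) * (2 ^ d) ^ (α / d) with hK
  have hKtop : K ≠ ⊤ := by
    refine ENNReal.mul_ne_top ?_ ?_
    · exact ENNReal.add_ne_top.2 ⟨(rieszMeasure_unitBall_lt_top hd hα).ne, ENNReal.one_ne_top⟩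
    · exact ENNReal.rpow_ne_top_of_nonneg (by positivity) (by simp)
  refine ⟨K.toReal + 1, by positivity, ?_⟩
  intro θ _ f g hf hg hf0 hg0 _ _
  have hKC : K ≤ ENNReal.ofReal (K.toReal + 1) := by
    rw [← ENNReal.ofReal_toReal hKtop, ENNReal.toReal_ofReal (by positivity)]
    exact ENNReal.ofReal_le_ofReal (by linarith)
  refine iSup₂_le fun l hl => ?_
  calc ENNReal.ofReal l * volume {x | l < |Ialpha d α θ f g x|} ^ (1 / p)
      ≤ ENNReal.ofReal l * volume {x | ENNReal.ofReal l < lIalpha d α θ f g x} ^ (1 / p) := by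
        gcongr with x
        intro hx
        exact ((ENNReal.ofReal_lt_ofReal_iff_of_nonneg hl.le).2 hx).trans_le
          (ofReal_abs_Ialpha_le hf hg hf0 hg0 x)
    _ ≤ K * (lorentzNorm p f * lorentzNorm (d / α) g) := by
        refine mul_measure_rpow_le_of_setLIntegral_le (measurable_lIalpha hf hg) (by positivity)
          (fun D hD => ?_) (by simpa using hl) ENNReal.ofReal_ne_top
        refine (setLIntegral_lIalpha_le hd hα hαd hp hpd hf hg hf0 hg0 hD).trans_eq ?_
        rw [hK]
        ring
    _ ≤ _ := by
        rw [← mul_assoc]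
        gcongr
end

section
/- Let d ∈ ℕ, θ ∈ [0,1], and j ∈ ℤ. There exists a constant c = c(d) > 0, independent of θ and j, such that for all nonnegative measurable functions f, g on ℝ^d, ‖I_j^θ(f,g)‖_{L^{1/2}(ℝ^d)} ≤ c · 2^{dj} ‖f‖_{L^1} ‖g‖_{L^1}, where ‖h‖_{L^{1/2}} = (∫_{ℝ^d} |h|^{1/2} dx)^2. -/
open MeasureTheory Set
open scoped ENNReal NNReal

/-- The truncated bilinear averaging operator
`I_j^θ(f,g)(x) = ∫_{|y| ≤ 2^j} f(x + (θ-1)y) g(x + θy) dy`. -/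
noncomputable def Ij (d : ℕ) (θ : ℝ) (j : ℤ) (f g : EuclideanSpace ℝ (Fin d) → ℝ)
    (x : EuclideanSpace ℝ (Fin d)) : ℝ :=
  ∫ y in {y : EuclideanSpace ℝ (Fin d) | ‖y‖ ≤ 2 ^ j}, f (x + (θ - 1) • y) * g (x + θ • y)

open Metric in
/-- Integrating the averages over balls of fixed radius. -/
lemma lintegral_setLIntegral_closedBall {E : Type*} [NormedAddCommGroup E] [NormedSpace ℝ E]
    [MeasurableSpace E] [BorelSpace E] [FiniteDimensional ℝ E] (μ : Measure E)
    [μ.IsAddHaarMeasure] (r : ℝ) {h : E → ℝ≥0∞} (hh : Measurable h) :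
    ∫⁻ z, ∫⁻ x in closedBall z r, h x ∂μ ∂μ = μ (closedBall 0 r) * ∫⁻ x, h x ∂μ := by
  have hS : MeasurableSet {p : E × E | dist p.2 p.1 ≤ r} :=
    (isClosed_le (by fun_prop) (by fun_prop)).measurableSet
  have hm : Measurable fun p : E × E ↦ {p : E × E | dist p.2 p.1 ≤ r}.indicator
      (fun p ↦ h p.2) p := (hh.comp measurable_snd).indicator hS
  calc ∫⁻ z, ∫⁻ x in closedBall z r, h x ∂μ ∂μ
      = ∫⁻ z, ∫⁻ x, {p : E × E | dist p.2 p.1 ≤ r}.indicator (fun p ↦ h p.2) (z, x) ∂μ ∂μ := by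
        refine lintegral_congr fun z ↦ ?_
        rw [← lintegral_indicator measurableSet_closedBall]
        rfl
    _ = ∫⁻ x, ∫⁻ z, {p : E × E | dist p.2 p.1 ≤ r}.indicator (fun p ↦ h p.2) (z, x) ∂μ ∂μ :=
        lintegral_lintegral_swap hm.aemeasurable
    _ = ∫⁻ x, μ (closedBall 0 r) * h x ∂μ := by
        refine lintegral_congr fun x ↦ ?_
        have : (fun z ↦ {p : E × E | dist p.2 p.1 ≤ r}.indicator (fun p ↦ h p.2) (z, x)) =
            (closedBall x r).indicator fun _ ↦ h x := by
          ext z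
          simp only [indicator, mem_ofPred_eq, mem_closedBall, dist_comm]
        rw [this, lintegral_indicator_const measurableSet_closedBall,
          Measure.addHaar_closedBall_center, mul_comm]
    _ = _ := lintegral_const_mul _ hh

/-- The map `(x, y) ↦ (x + (θ - 1) y, x + θ y)` preserves integrals of tensor products. -/
lemma lintegral_lintegral_mul_shear {E : Type*} [NormedAddCommGroup E] [NormedSpace ℝ E]
    [MeasurableSpace E] [BorelSpace E] [FiniteDimensional ℝ E] (μ : Measure E)
    [μ.IsAddHaarMeasure] (θ : ℝ) {φ γ : E → ℝ≥0∞} (hφ : Measurable φ) (hγ : Measurable γ) :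
    ∫⁻ x, ∫⁻ y, φ (x + (θ - 1) • y) * γ (x + θ • y) ∂μ ∂μ =
      (∫⁻ x, φ x ∂μ) * ∫⁻ x, γ x ∂μ := by
  calc ∫⁻ x, ∫⁻ y, φ (x + (θ - 1) • y) * γ (x + θ • y) ∂μ ∂μ
      = ∫⁻ y, ∫⁻ x, φ (x + (θ - 1) • y) * γ (x + θ • y) ∂μ ∂μ :=
        lintegral_lintegral_swap (by fun_prop)
    _ = ∫⁻ y, ∫⁻ x, φ x * γ (x + y) ∂μ ∂μ := by
        refine lintegral_congr fun y ↦ ?_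
        rw [← lintegral_add_right_eq_self (fun x ↦ φ x * γ (x + y)) ((θ - 1) • y)]
        refine lintegral_congr fun x ↦ ?_
        congr 2
        module
    _ = ∫⁻ x, ∫⁻ y, φ x * γ (x + y) ∂μ ∂μ := lintegral_lintegral_swap (by fun_prop)
    _ = ∫⁻ x, φ x * ∫⁻ y, γ y ∂μ ∂μ := by
        refine lintegral_congr fun x ↦ ?_
        rw [lintegral_const_mul _ (by fun_prop), lintegral_add_left_eq_self γ x]
    _ = _ := lintegral_mul_const _ hφ

open Metric in
/-- On a ball of radius `r`, the bilinear average at scale `r` only sees the values of the two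
functions on the ball of radius `2 * r`. -/
lemma setLIntegral_bilinear_average_le {E : Type*} [NormedAddCommGroup E] [NormedSpace ℝ E]
    [MeasurableSpace E] [BorelSpace E] [FiniteDimensional ℝ E] (μ : Measure E)
    [μ.IsAddHaarMeasure] {θ : ℝ} (hθ : θ ∈ Icc (0 : ℝ) 1) (r : ℝ) {φ γ : E → ℝ≥0∞}
    (hφ : Measurable φ) (hγ : Measurable γ) (z : E) :
    ∫⁻ x in closedBall z r, ∫⁻ y in closedBall 0 r,
        φ (x + (θ - 1) • y) * γ (x + θ • y) ∂μ ∂μ ≤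
      (∫⁻ x in closedBall z (2 * r), φ x ∂μ) * ∫⁻ x in closedBall z (2 * r), γ x ∂μ := by
  have hB : MeasurableSet (closedBall z (2 * r)) := measurableSet_closedBall
  have key : ∀ (t : ℝ), |t| ≤ 1 → ∀ x ∈ closedBall z r, ∀ y ∈ closedBall (0 : E) r,
      x + t • y ∈ closedBall z (2 * r) := by
    intro t ht x hx y hy
    rw [mem_closedBall, dist_eq_norm] at hx ⊢
    rw [mem_closedBall_zero_iff] at hy
    calc ‖x + t • y - z‖ = ‖(x - z) + t • y‖ := by congr 1; abel
      _ ≤ ‖x - z‖ + ‖t • y‖ := norm_add_le _ _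
      _ ≤ r + r := by
        gcongr
        rw [norm_smul, Real.norm_eq_abs]
        exact (mul_le_of_le_one_left (norm_nonneg y) ht).trans hy
      _ = 2 * r := by ring
  have h₁ : |θ - 1| ≤ 1 := abs_le.2 ⟨by linarith [hθ.1], by linarith [hθ.2]⟩
  have h₂ : |θ| ≤ 1 := abs_le.2 ⟨by linarith [hθ.1], hθ.2⟩
  rw [← lintegral_indicator hB φ, ← lintegral_indicator hB γ,
    ← lintegral_lintegral_mul_shear μ θ (hφ.indicator hB) (hγ.indicator hB)]
  refine le_trans (setLIntegral_mono' measurableSet_closedBall fun x hx ↦ ?_)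
    (setLIntegral_le_lintegral (closedBall z r) _)
  refine le_trans (setLIntegral_mono' measurableSet_closedBall fun y hy ↦ ?_)
    (setLIntegral_le_lintegral (closedBall 0 r) _)
  rw [indicator_of_mem (key _ h₁ x hx y hy), indicator_of_mem (key _ h₂ x hx y hy)]

open Metric in
/-- The `L^{1/2}` bound for the bilinear average of `ℝ≥0∞`-valued functions. -/
lemma lintegral_bilinear_average_rpow_le {E : Type*} [NormedAddCommGroup E] [NormedSpace ℝ E]
    [MeasurableSpace E] [BorelSpace E] [FiniteDimensional ℝ E] (μ : Measure E)
    [μ.IsAddHaarMeasure] {θ : ℝ} (hθ : θ ∈ Icc (0 : ℝ) 1) {r : ℝ} (hr : 0 < r)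
    {φ γ : E → ℝ≥0∞} (hφ : Measurable φ) (hγ : Measurable γ) :
    (∫⁻ x, (∫⁻ y in closedBall 0 r, φ (x + (θ - 1) • y) * γ (x + θ • y) ∂μ) ^ (1 / 2 : ℝ) ∂μ) ^
        (2 : ℝ) ≤
      ENNReal.ofReal (4 ^ Module.finrank ℝ E) * μ (closedBall 0 r) *
        (∫⁻ x, φ x ∂μ) * ∫⁻ x, γ x ∂μ := by
  set K : E → ℝ≥0∞ := fun x ↦ ∫⁻ y in closedBall 0 r, φ (x + (θ - 1) • y) * γ (x + θ • y) ∂μ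
  have hKm : Measurable K := Measurable.lintegral_prod_right (by fun_prop)
  set V := μ (closedBall (0 : E) r)
  have hV0 : V ≠ 0 := (measure_closedBall_pos μ 0 hr).ne'
  have hVt : V ≠ ∞ := measure_closedBall_lt_top.ne
  have hmeas : ∀ {h : E → ℝ≥0∞}, Measurable h →
      Measurable fun z ↦ ∫⁻ x in closedBall z (2 * r), h x ∂μ := by
    intro h hh
    have hS : MeasurableSet {p : E × E | dist p.2 p.1 ≤ 2 * r} :=
      (isClosed_le (by fun_prop) (by fun_prop)).measurableSet
    have : Measurable fun z ↦ ∫⁻ x,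
        {p : E × E | dist p.2 p.1 ≤ 2 * r}.indicator (fun p ↦ h p.2) (z, x) ∂μ :=
      ((hh.comp measurable_snd).indicator hS).lintegral_prod_right'
    convert this using 2 with z
    rw [← lintegral_indicator measurableSet_closedBall]
    rfl
  have hV2 : μ (closedBall (0 : E) (2 * r)) = ENNReal.ofReal (2 ^ Module.finrank ℝ E) * V := by
    rw [Measure.addHaar_closedBall_mul μ 0 zero_le_two hr.le]
  have h₁ : ∀ z, ∫⁻ x in closedBall z r, K x ^ (1 / 2 : ℝ) ∂μ ≤
      V ^ (1 / 2 : ℝ) * ((∫⁻ x in closedBall z (2 * r), φ x ∂μ) ^ (1 / 2 : ℝ) *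
        (∫⁻ x in closedBall z (2 * r), γ x ∂μ) ^ (1 / 2 : ℝ)) := by
    intro z
    have hCS := ENNReal.lintegral_mul_norm_pow_le (μ := μ.restrict (closedBall z r))
      (f := fun _ ↦ 1) (g := K) aemeasurable_const hKm.aemeasurable
      (p := 1 / 2) (q := 1 / 2) (by norm_num) (by norm_num) (by norm_num)
    simp only [ENNReal.one_rpow, one_mul, lintegral_const, Measure.restrict_apply MeasurableSet.univ,
      univ_inter, Measure.addHaar_closedBall_center] at hCS
    refine hCS.trans ?_
    rw [← ENNReal.mul_rpow_of_nonneg (∫⁻ x in closedBall z (2 * r), φ x ∂μ) _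
      (by norm_num : (0 : ℝ) ≤ 1 / 2)]
    gcongr
    exact setLIntegral_bilinear_average_le μ hθ r hφ hγ z
  have h₂ : V * ∫⁻ x, K x ^ (1 / 2 : ℝ) ∂μ ≤
      V * (V ^ (1 / 2 : ℝ) * (ENNReal.ofReal (2 ^ Module.finrank ℝ E) *
        ((∫⁻ x, φ x ∂μ) ^ (1 / 2 : ℝ) * (∫⁻ x, γ x ∂μ) ^ (1 / 2 : ℝ)))) := by
    rw [← lintegral_setLIntegral_closedBall μ r (hKm.pow_const _)]
    refine (lintegral_mono h₁).trans ?_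
    rw [lintegral_const_mul' _ _ (by finiteness)]
    refine (mul_le_mul_right (ENNReal.lintegral_mul_norm_pow_le (hmeas hφ).aemeasurable
      (hmeas hγ).aemeasurable (by norm_num) (by norm_num) (by norm_num)) _).trans_eq ?_
    rw [lintegral_setLIntegral_closedBall μ _ hφ, lintegral_setLIntegral_closedBall μ _ hγ, hV2,
      ENNReal.mul_rpow_of_nonneg _ (∫⁻ x, φ x ∂μ) (by norm_num : (0 : ℝ) ≤ 1 / 2),
      ENNReal.mul_rpow_of_nonneg _ (∫⁻ x, γ x ∂μ) (by norm_num : (0 : ℝ) ≤ 1 / 2), mul_mul_mul_comm,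
      ← ENNReal.rpow_add_of_nonneg _ _ (by norm_num) (by norm_num), add_halves, ENNReal.rpow_one]
    ring
  rw [ENNReal.mul_le_mul_iff_right hV0 hVt] at h₂
  refine (ENNReal.rpow_le_rpow h₂ zero_le_two).trans_eq ?_
  have hsq : ∀ a : ℝ≥0∞, (a ^ (1 / 2 : ℝ)) ^ (2 : ℝ) = a := fun a ↦ by
    rw [← ENNReal.rpow_mul]; norm_num
  simp only [ENNReal.mul_rpow_of_nonneg _ _ (zero_le_two : (0 : ℝ) ≤ 2), hsq]
  rw [ENNReal.ofReal_rpow_of_nonneg (by positivity) zero_le_two, Real.rpow_two, ← pow_mul,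
    mul_comm _ 2, pow_mul]
  norm_num
  ring

/-- `‖I_j^θ(f,g)‖_{L^{1/2}} ≤ c 2^{dj} ‖f‖_{L^1} ‖g‖_{L^1}`, with `c = c(d)`
independent of `θ` and `j`. -/
theorem Ij_Lhalf_bound (d : ℕ) (hd : 0 < d) :
    ∃ c : ℝ, 0 < c ∧ ∀ θ : ℝ, θ ∈ Set.Icc (0 : ℝ) 1 → ∀ j : ℤ,
      ∀ f g : EuclideanSpace ℝ (Fin d) → ℝ, Measurable f → Measurable g →
        0 ≤ f → 0 ≤ g →
        eLpNorm (Ij d θ j f g) (ENNReal.ofReal (1 / 2)) volume ≤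
          ENNReal.ofReal (c * 2 ^ ((d : ℤ) * j)) * eLpNorm f 1 volume * eLpNorm g 1 volume := by
  have hV0 : 0 < (volume (Metric.closedBall (0 : EuclideanSpace ℝ (Fin d)) 1)).toReal :=
    ENNReal.toReal_pos (Metric.measure_closedBall_pos _ _ one_pos).ne'
      measure_closedBall_lt_top.ne
  refine ⟨4 ^ d * (volume (Metric.closedBall (0 : EuclideanSpace ℝ (Fin d)) 1)).toReal,
    by positivity, fun θ hθ j f g hf hg _ _ ↦ ?_⟩
  have hr : (0 : ℝ) < 2 ^ j := by positivity
  have hball : {y : EuclideanSpace ℝ (Fin d) | ‖y‖ ≤ 2 ^ j} = Metric.closedBall 0 (2 ^ j) := by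
    ext y
    simp
  have hvol : volume (Metric.closedBall (0 : EuclideanSpace ℝ (Fin d)) (2 ^ j)) =
      ENNReal.ofReal (2 ^ ((d : ℤ) * j)) *
        volume (Metric.closedBall (0 : EuclideanSpace ℝ (Fin d)) 1) := by
    rw [Measure.addHaar_closedBall' volume 0 hr.le, finrank_euclideanSpace_fin, mul_comm (d : ℤ) j,
      zpow_mul, zpow_natCast]
  have hconst : ENNReal.ofReal (4 ^ d *
      (volume (Metric.closedBall (0 : EuclideanSpace ℝ (Fin d)) 1)).toReal * 2 ^ ((d : ℤ) * j)) =
      ENNReal.ofReal (4 ^ d) * volume (Metric.closedBall (0 : EuclideanSpace ℝ (Fin d)) (2 ^ j)) := by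
    rw [hvol, ENNReal.ofReal_mul (by positivity), ENNReal.ofReal_mul (by positivity),
      ENNReal.ofReal_toReal measure_closedBall_lt_top.ne]
    ring
  rw [eLpNorm_eq_lintegral_rpow_enorm_toReal (by simp) ENNReal.ofReal_ne_top,
    ENNReal.toReal_ofReal (by norm_num), eLpNorm_one_eq_lintegral_enorm,
    eLpNorm_one_eq_lintegral_enorm, hconst, one_div_one_div]
  have hmain := lintegral_bilinear_average_rpow_le
    (volume : Measure (EuclideanSpace ℝ (Fin d))) hθ hr hf.enorm hg.enorm
  rw [finrank_euclideanSpace_fin] at hmain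
  refine le_trans ?_ hmain
  gcongr with x
  rw [Ij, hball]
  refine (enorm_integral_le_lintegral_enorm _).trans_eq ?_
  simp only [enorm_mul]
end

section
/- Let d ∈ ℕ, θ ∈ [0,1], j ∈ ℤ, and 1 ≤ p ≤ ∞. There exists a constant c = c(d, p) > 0, independent of θ and j, such that for all nonnegative measurable functions f, g on ℝ^d, ‖I_j^θ(f,g)‖_{L^{p/(p+1)}(ℝ^d)} ≤ c · 2^{dj} ‖f‖_{L^1} ‖g‖_{L^p}. -/
open MeasureTheory Set
open scoped ENNReal NNReal

section BallAverages

open Metric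

variable {E : Type*} [NormedAddCommGroup E] [MeasurableSpace E] [BorelSpace E] (μ : Measure E)
  [μ.IsAddHaarMeasure]

/-- The mass `∫_{|x - z| ≤ R} h(x) dx` of a nonnegative function on a closed ball. -/
noncomputable def ballMass (R : ℝ) (h : E → ℝ≥0∞) (z : E) : ℝ≥0∞ :=
  ∫⁻ x in closedBall z R, h x ∂μ

lemma ballMass_le (R : ℝ) {a b : ℝ} (ha : 0 < a) (hab : a ≤ b) {h : E → ℝ≥0∞}
    (hh : Measurable h) (z : E) :
    ballMass μ R (fun x => h x ^ a) z ^ (1 / a) ≤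
      ballMass μ R (fun x => h x ^ b) z ^ (1 / b) * μ (closedBall 0 R) ^ (1 / a - 1 / b) := by
  have := eLpNorm'_le_eLpNorm'_mul_rpow_measure_univ (μ := μ.restrict (closedBall z R)) ha hab
    hh.aestronglyMeasurable
  simpa [eLpNorm'_eq_lintegral_enorm, ballMass, Measure.addHaar_closedBall_center μ z] using this

variable [NormedSpace ℝ E] [FiniteDimensional ℝ E]

lemma measurable_indicator_closedBall (R : ℝ) {h : E → ℝ≥0∞} (hh : Measurable h) :
    Measurable (Function.uncurry fun z x : E => (closedBall z R).indicator h x) := by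
  have hS : MeasurableSet {q : E × E | dist q.2 q.1 ≤ R} :=
    (isClosed_le (by fun_prop) (by fun_prop)).measurableSet
  exact (hh.comp measurable_snd).indicator hS

lemma measurable_ballMass (R : ℝ) {h : E → ℝ≥0∞} (hh : Measurable h) :
    Measurable (ballMass μ R h) := by
  have := (measurable_indicator_closedBall R hh).lintegral_prod_right (ν := μ)
  simp only [lintegral_indicator measurableSet_closedBall] at this
  exact this

lemma lintegral_ballMass (R : ℝ) {h : E → ℝ≥0∞} (hh : Measurable h) :
    ∫⁻ z, ballMass μ R h z ∂μ = μ (closedBall 0 R) * ∫⁻ x, h x ∂μ := by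
  calc ∫⁻ z, ballMass μ R h z ∂μ
      = ∫⁻ z, ∫⁻ x, (closedBall z R).indicator h x ∂μ ∂μ := by
        simp only [ballMass, lintegral_indicator measurableSet_closedBall]
    _ = ∫⁻ x, ∫⁻ z, (closedBall z R).indicator h x ∂μ ∂μ :=
        lintegral_lintegral_swap (measurable_indicator_closedBall R hh).aemeasurable
    _ = ∫⁻ x, μ (closedBall 0 R) * h x ∂μ := by
        refine lintegral_congr fun x => ?_
        have hsymm : (fun z => (closedBall z R).indicator h x) =
            (closedBall x R).indicator fun _ => h x := by
          ext z
          simp only [indicator, mem_closedBall, dist_comm]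
        rw [hsymm, lintegral_indicator_const measurableSet_closedBall,
          Measure.addHaar_closedBall_center, mul_comm]
    _ = _ := lintegral_const_mul _ hh

lemma eLpNorm_ballMass_le {R : ℝ} (hR : 0 < R) {p : ℝ≥0∞} (hp : 1 ≤ p) {h : E → ℝ≥0∞}
    (hh : Measurable h) :
    eLpNorm (ballMass μ R h) p μ ≤ μ (closedBall 0 R) * eLpNorm h p μ := by
  rcases eq_or_ne p ∞ with rfl | hp_top
  · simp only [eLpNorm_exponent_top]
    refine eLpNormEssSup_le_of_ae_enorm_bound (.of_forall fun z => ?_)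
    calc ballMass μ R h z ≤ ∫⁻ _ in closedBall z R, eLpNormEssSup h μ ∂μ :=
          lintegral_mono_ae (ae_restrict_of_ae (enorm_ae_le_eLpNormEssSup h μ))
      _ = _ := by
          rw [setLIntegral_const, Measure.addHaar_closedBall_center, mul_comm]
  · have hp0 : p ≠ 0 := (zero_lt_one.trans_le hp).ne'
    have hq : 1 ≤ p.toReal := by
      simpa using (ENNReal.toReal_le_toReal ENNReal.one_ne_top hp_top).2 hp
    have hq0 : 0 < p.toReal := by linarith
    simp only [eLpNorm_eq_lintegral_rpow_enorm_toReal hp0 hp_top, enorm_eq_self]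
    set q := p.toReal
    set V := μ (closedBall (0 : E) R)
    have hV0 : V ≠ 0 := (measure_closedBall_pos μ 0 hR).ne'
    have hVt : V ≠ ∞ := measure_closedBall_lt_top.ne
    rw [one_div, ENNReal.rpow_inv_le_iff hq0, ENNReal.mul_rpow_of_nonneg _ _ hq0.le,
      ENNReal.rpow_inv_rpow hq0.ne']
    calc ∫⁻ z, ballMass μ R h z ^ q ∂μ
        ≤ ∫⁻ z, V ^ (q - 1) * ballMass μ R (fun x => h x ^ q) z ∂μ := by
          refine lintegral_mono fun z => ?_
          have hz := ENNReal.rpow_le_rpow (ballMass_le μ R one_pos hq hh z) hq0.le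
          rw [ENNReal.mul_rpow_of_nonneg _ _ hq0.le, ← ENNReal.rpow_mul, ← ENNReal.rpow_mul,
            ← ENNReal.rpow_mul, one_div_mul_cancel hq0.ne', sub_mul, one_div_mul_cancel hq0.ne'] at hz
          simpa [mul_comm] using hz
      _ = V ^ (q - 1) * (V * ∫⁻ x, h x ^ q ∂μ) := by
          rw [lintegral_const_mul _ (measurable_ballMass μ R (hh.pow_const q)),
            lintegral_ballMass μ R (hh.pow_const q)]
      _ = V ^ q * ∫⁻ x, h x ^ q ∂μ := by
          rw [← mul_assoc]
          congr 1
          nth_rw 2 [← ENNReal.rpow_one V]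
          rw [← ENNReal.rpow_add _ _ hV0 hVt, sub_add_cancel]

/-- The truncated bilinear average of two nonnegative extended-real-valued functions. -/
noncomputable def bilinearAverage (θ r : ℝ) (f g : E → ℝ≥0∞) (x : E) : ℝ≥0∞ :=
  ∫⁻ y in closedBall 0 r, f (x + (θ - 1) • y) * g (x + θ • y) ∂μ

lemma measurable_bilinearAverage (θ r : ℝ) {f g : E → ℝ≥0∞} (hf : Measurable f)
    (hg : Measurable g) : Measurable (bilinearAverage μ θ r f g) :=
  Measurable.lintegral_prod_right (f := fun x y : E => f (x + (θ - 1) • y) * g (x + θ • y))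
    (by unfold Function.uncurry; fun_prop)

lemma lintegral_bilinearAverage_le (θ r : ℝ) {f g : E → ℝ≥0∞} (hf : Measurable f)
    (hg : Measurable g) :
    ∫⁻ x, bilinearAverage μ θ r f g x ∂μ ≤ (∫⁻ x, f x ∂μ) * ∫⁻ x, g x ∂μ := by
  calc ∫⁻ x, bilinearAverage μ θ r f g x ∂μ
      ≤ ∫⁻ x, ∫⁻ y, f (x + (θ - 1) • y) * g (x + θ • y) ∂μ ∂μ :=
        lintegral_mono fun x => setLIntegral_le_lintegral _ _
    _ = ∫⁻ y, ∫⁻ x, f (x + (θ - 1) • y) * g (x + θ • y) ∂μ ∂μ :=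
        lintegral_lintegral_swap (by unfold Function.uncurry; fun_prop)
    _ = ∫⁻ y, ∫⁻ x, f x * g (x + y) ∂μ ∂μ := by
        refine lintegral_congr fun y => ?_
        rw [← lintegral_add_right_eq_self (fun x => f x * g (x + y)) ((θ - 1) • y)]
        refine lintegral_congr fun x => ?_
        congr 2
        module
    _ = ∫⁻ x, ∫⁻ y, f x * g (x + y) ∂μ ∂μ :=
        lintegral_lintegral_swap (by unfold Function.uncurry; fun_prop)
    _ = ∫⁻ x, f x * ∫⁻ y, g y ∂μ ∂μ := by
        refine lintegral_congr fun x => ?_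
        rw [lintegral_const_mul _ (by fun_prop), lintegral_add_left_eq_self]
    _ = _ := lintegral_mul_const _ hf

lemma ballMass_bilinearAverage_le {θ r : ℝ} (hθ : θ ∈ Icc (0 : ℝ) 1) {f g : E → ℝ≥0∞}
    (hf : Measurable f) (hg : Measurable g) (z : E) :
    ballMass μ r (bilinearAverage μ θ r f g) z ≤
      ballMass μ (2 * r) f z * ballMass μ (2 * r) g z := by
  set B := closedBall z (2 * r)
  have hB : MeasurableSet B := measurableSet_closedBall
  have hmem : ∀ x ∈ closedBall z r, ∀ y ∈ closedBall (0 : E) r, ∀ t : ℝ, |t| ≤ 1 →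
      x + t • y ∈ B := by
    intro x hx y hy t ht
    rw [mem_closedBall_iff_norm] at hx ⊢
    rw [mem_closedBall_zero_iff] at hy
    have hty : ‖t • y‖ ≤ ‖y‖ := by
      rw [norm_smul, Real.norm_eq_abs]
      exact mul_le_of_le_one_left (norm_nonneg y) ht
    calc ‖x + t • y - z‖ = ‖(x - z) + t • y‖ := by congr 1; abel
      _ ≤ ‖x - z‖ + ‖t • y‖ := norm_add_le _ _
      _ ≤ 2 * r := by linarith
  have h₁ : |θ - 1| ≤ 1 := abs_le.2 ⟨by linarith [hθ.1], by linarith [hθ.2]⟩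
  have h₂ : |θ| ≤ 1 := abs_le.2 ⟨by linarith [hθ.1], hθ.2⟩
  calc ballMass μ r (bilinearAverage μ θ r f g) z
      ≤ ∫⁻ x in closedBall z r,
          bilinearAverage μ θ r (B.indicator f) (B.indicator g) x ∂μ := by
        refine setLIntegral_mono' measurableSet_closedBall fun x hx => ?_
        refine setLIntegral_mono' measurableSet_closedBall fun y hy => ?_
        rw [indicator_of_mem (hmem x hx y hy _ h₁), indicator_of_mem (hmem x hx y hy _ h₂)]
    _ ≤ ∫⁻ x, bilinearAverage μ θ r (B.indicator f) (B.indicator g) x ∂μ :=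
        setLIntegral_le_lintegral _ _
    _ ≤ _ := lintegral_bilinearAverage_le μ θ r (hf.indicator hB) (hg.indicator hB)
    _ = _ := by simp only [lintegral_indicator hB, ballMass, B]

end BallAverages

lemma ne_zero_and_le_one_of_one_div_eq {p s : ℝ≥0∞} (hp : 1 ≤ p) (hs : 1 / s = 1 / p + 1) :
    s ≠ 0 ∧ s ≤ 1 := by
  have hp0 : p ≠ 0 := (zero_lt_one.trans_le hp).ne'
  constructor
  · rintro rfl
    have htop : 1 / p + 1 ≠ ∞ := by simp [hp0]
    exact htop (hs ▸ by simp)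
  · rw [← ENNReal.inv_le_inv, inv_one, ← one_div, hs]
    exact le_add_self

lemma eLpNorm_mul_le_of_one_div_eq {α : Type*} [MeasurableSpace α] (μ : Measure α)
    {p s : ℝ≥0∞} (hp : 1 ≤ p) (hs : 1 / s = 1 / p + 1) {f g : α → ℝ≥0∞} (hf : Measurable f)
    (hg : Measurable g) :
    eLpNorm (f * g) s μ ≤ eLpNorm f 1 μ * eLpNorm g p μ := by
  rcases eq_or_ne p ∞ with rfl | hp_top
  · obtain rfl : s = 1 := by simpa using hs
    simp only [eLpNorm_one_eq_lintegral_enorm, eLpNorm_exponent_top, enorm_eq_self]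
    rw [← lintegral_mul_const _ hf]
    refine lintegral_mono_ae ?_
    filter_upwards [enorm_ae_le_eLpNormEssSup g μ] with x hx
    exact mul_le_mul_right hx _
  · have hp0 : p ≠ 0 := (zero_lt_one.trans_le hp).ne'
    obtain ⟨hs0, hs_le⟩ := ne_zero_and_le_one_of_one_div_eq hp hs
    have hs_top : s ≠ ∞ := (hs_le.trans_lt ENNReal.one_lt_top).ne
    have hq0 : 0 < p.toReal := ENNReal.toReal_pos hp0 hp_top
    have ht0 : 0 < s.toReal := ENNReal.toReal_pos hs0 hs_top
    have hst : 1 / s.toReal = 1 / 1 + 1 / p.toReal := by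
      have := congrArg ENNReal.toReal hs
      rw [ENNReal.toReal_add (by simp [hp0]) (by simp)] at this
      simpa [add_comm] using this
    have hs1 : s.toReal < 1 := by
      have : 0 < 1 / p.toReal := by positivity
      refine (one_lt_div ht0).1 ?_
      linarith
    have := ENNReal.lintegral_Lp_mul_le_Lq_mul_Lr ht0 hs1 hst μ hf.aemeasurable hg.aemeasurable
    simpa [eLpNorm_eq_lintegral_rpow_enorm_toReal, hp0, hs0, hp_top, hs_top] using this

lemma eLpNorm_bilinearAverage_le {E : Type*} [NormedAddCommGroup E] [NormedSpace ℝ E]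
    [FiniteDimensional ℝ E] [MeasurableSpace E] [BorelSpace E] (μ : Measure E)
    [μ.IsAddHaarMeasure] {p s : ℝ≥0∞} (hp : 1 ≤ p) (hs : 1 / s = 1 / p + 1) {θ r : ℝ}
    (hθ : θ ∈ Icc (0 : ℝ) 1) (hr : 0 < r) {f g : E → ℝ≥0∞} (hf : Measurable f)
    (hg : Measurable g) :
    μ (Metric.closedBall 0 r) * eLpNorm (bilinearAverage μ θ r f g) s μ ≤
      μ (Metric.closedBall 0 (2 * r)) ^ 2 * (eLpNorm f 1 μ * eLpNorm g p μ) := by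
  obtain ⟨hs0, hs1⟩ := ne_zero_and_le_one_of_one_div_eq hp hs
  have hs_top : s ≠ ∞ := (hs1.trans_lt ENNReal.one_lt_top).ne
  have ht0 : 0 < s.toReal := ENNReal.toReal_pos hs0 hs_top
  have ht1 : s.toReal ≤ 1 := by
    simpa using (ENNReal.toReal_le_toReal hs_top ENNReal.one_ne_top).2 hs1
  set J := bilinearAverage μ θ r f g
  have hJ : Measurable J := measurable_bilinearAverage μ θ r hf hg
  set F := ballMass μ (2 * r) f
  set G := ballMass μ (2 * r) g
  have hF : Measurable F := measurable_ballMass μ _ hf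
  have hG : Measurable G := measurable_ballMass μ _ hg
  set V := μ (Metric.closedBall (0 : E) r)
  set W := μ (Metric.closedBall (0 : E) (2 * r))
  have hV0 : V ≠ 0 := (Metric.measure_closedBall_pos μ 0 hr).ne'
  have hVt : V ≠ ∞ := measure_closedBall_lt_top.ne
  have key : V * eLpNorm J s μ ≤ eLpNorm (F * G) s μ := by
    simp only [eLpNorm_eq_lintegral_rpow_enorm_toReal hs0 hs_top, enorm_eq_self]
    set t := s.toReal
    rw [one_div, ENNReal.le_rpow_inv_iff ht0, ENNReal.mul_rpow_of_nonneg _ _ ht0.le,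
      ENNReal.rpow_inv_rpow ht0.ne']
    have hpt : ∀ z, ballMass μ r (fun x => J x ^ t) z ≤ V ^ (1 - t) * (F * G) z ^ t := by
      intro z
      have hz := ENNReal.rpow_le_rpow (ballMass_le μ r ht0 ht1 hJ z) ht0.le
      rw [ENNReal.mul_rpow_of_nonneg _ _ ht0.le, ← ENNReal.rpow_mul, ← ENNReal.rpow_mul,
        ← ENNReal.rpow_mul, one_div_mul_cancel ht0.ne', sub_mul,
        one_div_mul_cancel ht0.ne'] at hz
      simp only [div_one, one_mul, ENNReal.rpow_one] at hz
      rw [mul_comm]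
      refine hz.trans (mul_le_mul_left (ENNReal.rpow_le_rpow ?_ ht0.le) _)
      exact ballMass_bilinearAverage_le μ hθ hf hg z
    have hint : V * ∫⁻ x, J x ^ t ∂μ ≤ V ^ (1 - t) * ∫⁻ z, (F * G) z ^ t ∂μ := by
      rw [← lintegral_ballMass μ r (hJ.pow_const t),
        ← lintegral_const_mul _ ((hF.mul hG).pow_const t)]
      exact lintegral_mono hpt
    have hsplit : V = V ^ (1 - t) * V ^ t := by
      rw [← ENNReal.rpow_add _ _ hV0 hVt, sub_add_cancel, ENNReal.rpow_one]
    nth_rw 1 [hsplit] at hint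
    rw [mul_assoc] at hint
    exact (ENNReal.mul_le_mul_iff_right
      (ENNReal.rpow_pos (pos_iff_ne_zero.2 hV0) hVt).ne'
      (ENNReal.rpow_ne_top_of_ne_zero hV0 hVt)).1 hint
  calc V * eLpNorm J s μ ≤ eLpNorm (F * G) s μ := key
    _ ≤ eLpNorm F 1 μ * eLpNorm G p μ := eLpNorm_mul_le_of_one_div_eq μ hp hs hF hG
    _ ≤ (W * eLpNorm f 1 μ) * (W * eLpNorm g p μ) :=
        mul_le_mul' (eLpNorm_ballMass_le μ (by positivity) le_rfl hf)
          (eLpNorm_ballMass_le μ (by positivity) hp hg)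
    _ = _ := by ring

/-- `‖I_j^θ(f,g)‖_{L^{p/(p+1)}} ≤ c 2^{dj} ‖f‖_{L^1} ‖g‖_{L^p}` for `1 ≤ p ≤ ∞`,
with `c = c(d,p)` independent of `θ` and `j`.  The exponent `s = p/(p+1)` is
encoded by `1/s = 1/p + 1`. -/
theorem Ij_mixed_bound_left (d : ℕ) (hd : 0 < d) (p s : ℝ≥0∞) (hp : 1 ≤ p)
    (hs : 1 / s = 1 / p + 1) :
    ∃ c : ℝ, 0 < c ∧ ∀ θ : ℝ, θ ∈ Set.Icc (0 : ℝ) 1 → ∀ j : ℤ,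
      ∀ f g : EuclideanSpace ℝ (Fin d) → ℝ, Measurable f → Measurable g →
        0 ≤ f → 0 ≤ g →
        eLpNorm (Ij d θ j f g) s volume ≤
          ENNReal.ofReal (c * 2 ^ ((d : ℤ) * j)) * eLpNorm f 1 volume * eLpNorm g p volume := by
  set v : ℝ := (volume (Metric.closedBall (0 : EuclideanSpace ℝ (Fin d)) 1)).toReal
  have hv_top : volume (Metric.closedBall (0 : EuclideanSpace ℝ (Fin d)) 1) ≠ ∞ :=
    measure_closedBall_lt_top.ne
  have hv : 0 < v := ENNReal.toReal_pos (Metric.measure_closedBall_pos volume 0 one_pos).ne' hv_top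
  have hball : ∀ R : ℝ, 0 ≤ R →
      volume (Metric.closedBall (0 : EuclideanSpace ℝ (Fin d)) R) =
        ENNReal.ofReal (R ^ d * v) := by
    intro R hR
    rw [Measure.addHaar_closedBall' volume 0 hR, finrank_euclideanSpace_fin,
      ENNReal.ofReal_mul (by positivity), ENNReal.ofReal_toReal hv_top]
  refine ⟨4 ^ d * v, by positivity, fun θ hθ j f g hf hg _ _ => ?_⟩
  set r : ℝ := 2 ^ j with hr_def
  have hr : 0 < r := by positivity
  set J := bilinearAverage volume θ r (fun x => ‖f x‖ₑ) (fun x => ‖g x‖ₑ)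
  have hIJ : eLpNorm (Ij d θ j f g) s volume ≤ eLpNorm J s volume := by
    refine eLpNorm_mono_enorm fun x => ?_
    have hset : {y : EuclideanSpace ℝ (Fin d) | ‖y‖ ≤ 2 ^ j} = Metric.closedBall 0 r := by
      ext y
      simp [hr_def]
    rw [Ij, hset]
    refine (enorm_integral_le_lintegral_enorm _).trans_eq ?_
    simp only [enorm_mul, enorm_eq_self, J, bilinearAverage]
  have hJ := eLpNorm_bilinearAverage_le volume hp hs hθ hr hf.enorm hg.enorm
  simp only [eLpNorm_enorm] at hJ
  rw [hball r hr.le, hball (2 * r) (by positivity)] at hJ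
  have hconst : ENNReal.ofReal ((2 * r) ^ d * v) ^ 2 =
      ENNReal.ofReal (r ^ d * v) * ENNReal.ofReal (4 ^ d * v * 2 ^ ((d : ℤ) * j)) := by
    rw [← ENNReal.ofReal_pow (by positivity), ← ENNReal.ofReal_mul (by positivity)]
    congr 1
    rw [mul_comm (d : ℤ) j, zpow_mul, zpow_natCast, ← hr_def, show (4 : ℝ) = 2 * 2 by norm_num]
    simp only [mul_pow]
    ring
  rw [hconst, mul_assoc] at hJ
  rw [mul_assoc]
  exact hIJ.trans ((ENNReal.mul_le_mul_iff_right
    (ENNReal.ofReal_pos.2 (by positivity)).ne' ENNReal.ofReal_ne_top).1 hJ)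
end

section
/- Let d ∈ ℕ, θ ∈ [0,1], j ∈ ℤ, and 1 ≤ p ≤ ∞. There exists a constant c = c(d, p) > 0, independent of θ and j, such that for all nonnegative measurable functions f, g on ℝ^d, ‖I_j^θ(f,g)‖_{L^{p/(p+1)}(ℝ^d)} ≤ c · 2^{dj} ‖f‖_{L^p} ‖g‖_{L^1}. -/
open MeasureTheory Set
open scoped ENNReal NNReal

/-- Jensen's inequality for the concave power `t ↦ t ^ s`, `0 < s ≤ 1`. -/
theorem lintegral_rpow_le_measure_univ_rpow_mul {α : Type*} [MeasurableSpace α] {μ : Measure α}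
    {s : ℝ} (hs0 : 0 < s) (hs1 : s ≤ 1) {h : α → ℝ≥0∞} (hh : Measurable h) :
    ∫⁻ x, h x ^ s ∂μ ≤ μ univ ^ (1 - s) * (∫⁻ x, h x ∂μ) ^ s := by
  have key := eLpNorm'_le_eLpNorm'_mul_rpow_measure_univ (μ := μ) hs0 hs1
    hh.aestronglyMeasurable
  simp only [eLpNorm'_eq_lintegral_enorm, enorm_eq_self, ENNReal.rpow_one, div_one] at key
  rw [one_div, ENNReal.rpow_inv_le_iff hs0, ENNReal.mul_rpow_of_nonneg _ _ hs0.le,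
    ← ENNReal.rpow_mul, sub_mul, inv_mul_cancel₀ hs0.ne', one_mul, mul_comm] at key
  exact key

/-- Jensen's inequality for the convex power `t ↦ t ^ p`, `1 ≤ p`. -/
theorem rpow_lintegral_le_measure_univ_rpow_mul {α : Type*} [MeasurableSpace α] {μ : Measure α}
    {p : ℝ} (hp : 1 ≤ p) {h : α → ℝ≥0∞} (hh : Measurable h) :
    (∫⁻ x, h x ∂μ) ^ p ≤ μ univ ^ (p - 1) * ∫⁻ x, h x ^ p ∂μ := by
  have hp0 : 0 < p := by linarith
  have key := eLpNorm'_le_eLpNorm'_mul_rpow_measure_univ (μ := μ) one_pos hp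
    hh.aestronglyMeasurable
  simp only [eLpNorm'_eq_lintegral_enorm, enorm_eq_self, ENNReal.rpow_one, div_one] at key
  have key' := ENNReal.rpow_le_rpow key hp0.le
  rw [ENNReal.mul_rpow_of_nonneg _ _ hp0.le, ← ENNReal.rpow_mul, ← ENNReal.rpow_mul,
    one_div_mul_cancel hp0.ne', ENNReal.rpow_one, sub_mul, one_div_mul_cancel hp0.ne',
    one_mul, mul_comm] at key'
  exact key'

/-- Hölder's inequality for the exponents `1 / s = 1 / p + 1`. -/
theorem lintegral_mul_rpow_le_Lp_mul_L1 {α : Type*} [MeasurableSpace α] {μ : Measure α}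
    {p s : ℝ} (hp : 0 < p) (hs : 0 < s) (hps : 1 / s = 1 / p + 1) {F G : α → ℝ≥0∞}
    (hF : Measurable F) (hG : Measurable G) :
    ∫⁻ x, (F x * G x) ^ s ∂μ ≤ ((∫⁻ x, F x ^ p ∂μ) ^ (1 / p) * ∫⁻ x, G x ∂μ) ^ s := by
  have hsp : s < p := by
    rw [← one_div_lt_one_div hp hs]
    linarith
  have key := ENNReal.lintegral_Lp_mul_le_Lq_mul_Lr hs hsp
    (r := 1) (by rw [hps, one_div_one]) μ hF.aemeasurable hG.aemeasurable
  simp only [Pi.mul_apply, ENNReal.rpow_one, div_one] at key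
  rwa [one_div, ENNReal.rpow_inv_le_iff hs] at key

section BilinearAverage

variable {E : Type*} [NormedAddCommGroup E] [NormedSpace ℝ E] [FiniteDimensional ℝ E]
  [MeasurableSpace E] [BorelSpace E] (μ : Measure E) [μ.IsAddHaarMeasure]

/-- The average of `x ↦ ∫⁻ t in A, h (x + t)` over the whole space. -/
theorem lintegral_setLIntegral_add (A : Set E) {h : E → ℝ≥0∞} (hh : Measurable h) :
    ∫⁻ z, ∫⁻ t in A, h (z + t) ∂μ ∂μ = μ A * ∫⁻ x, h x ∂μ := by
  have := FiniteDimensional.proper ℝ E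
  rw [lintegral_lintegral_swap (by fun_prop)]
  simp only [lintegral_add_right_eq_self h]
  rw [lintegral_const, Measure.restrict_apply_univ, mul_comm]

theorem measurable_setLIntegral_add (A : Set E) {h : E → ℝ≥0∞} (hh : Measurable h) :
    Measurable fun z ↦ ∫⁻ t in A, h (z + t) ∂μ := by
  have := FiniteDimensional.proper ℝ E
  exact Measurable.lintegral_prod_right' (f := fun q : E × E ↦ h (q.1 + q.2)) (by fun_prop)

/-- The truncated bilinear average of nonnegative extended-valued functions. -/
noncomputable def lbilinAvg (A : Set E) (θ : ℝ) (φ ψ : E → ℝ≥0∞) (x : E) : ℝ≥0∞ :=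
  ∫⁻ y in A, φ (x + (θ - 1) • y) * ψ (x + θ • y) ∂μ

theorem measurable_lbilinAvg (A : Set E) (θ : ℝ) {φ ψ : E → ℝ≥0∞} (hφ : Measurable φ)
    (hψ : Measurable ψ) : Measurable (lbilinAvg μ A θ φ ψ) := by
  have := FiniteDimensional.proper ℝ E
  exact Measurable.lintegral_prod_right'
    (f := fun q : E × E ↦ φ (q.1 + (θ - 1) • q.2) * ψ (q.1 + θ • q.2)) (by fun_prop)

theorem lintegral_lbilinAvg (A : Set E) (θ : ℝ) {φ ψ : E → ℝ≥0∞} (hφ : Measurable φ)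
    (hψ : Measurable ψ) :
    ∫⁻ x, lbilinAvg μ A θ φ ψ x ∂μ = ∫⁻ y in A, ∫⁻ x, φ (x - y) * ψ x ∂μ ∂μ := by
  have := FiniteDimensional.proper ℝ E
  unfold lbilinAvg
  rw [lintegral_lintegral_swap (by fun_prop)]
  refine lintegral_congr fun y ↦ ?_
  rw [← lintegral_add_right_eq_self (fun x ↦ φ (x - y) * ψ x) (θ • y)]
  refine lintegral_congr fun x ↦ ?_
  rw [sub_smul, one_smul, add_sub_assoc]

/-- The `L^∞ × L^1 → L^1` bound. -/
theorem lintegral_lbilinAvg_le (A : Set E) (θ : ℝ) {φ ψ : E → ℝ≥0∞} (hφ : Measurable φ)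
    (hψ : Measurable ψ) {C : ℝ≥0∞} (hC : ∀ᵐ x ∂μ, φ x ≤ C) :
    ∫⁻ x, lbilinAvg μ A θ φ ψ x ∂μ ≤ μ A * C * ∫⁻ x, ψ x ∂μ := by
  rw [lintegral_lbilinAvg μ A θ hφ hψ]
  calc ∫⁻ y in A, ∫⁻ x, φ (x - y) * ψ x ∂μ ∂μ ≤ ∫⁻ _ in A, C * ∫⁻ x, ψ x ∂μ ∂μ := by
        refine lintegral_mono fun y ↦ ?_
        rw [← lintegral_const_mul C hψ]
        refine lintegral_mono_ae ?_
        filter_upwards [(measurePreserving_sub_right μ y).quasiMeasurePreserving.ae hC] with x hx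
        gcongr
    _ = μ A * C * ∫⁻ x, ψ x ∂μ := by
        rw [lintegral_const, Measure.restrict_apply_univ]
        ring

/-- The average over a ball is controlled by the masses of both functions on the doubled ball. -/
theorem setLIntegral_lbilinAvg_closedBall_le {R : ℝ} {θ : ℝ} (hθ : θ ∈ Icc (0 : ℝ) 1)
    {φ ψ : E → ℝ≥0∞} (hφ : Measurable φ) (hψ : Measurable ψ) (z : E) :
    ∫⁻ t in Metric.closedBall 0 R,
        lbilinAvg μ (Metric.closedBall 0 R) θ φ ψ (z + t) ∂μ ≤
      (∫⁻ t in Metric.closedBall 0 (2 * R), φ (z + t) ∂μ) *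
        ∫⁻ t in Metric.closedBall 0 (2 * R), ψ (z + t) ∂μ := by
  have := FiniteDimensional.proper ℝ E
  set A : Set E := Metric.closedBall 0 R with hA
  set B : Set E := Metric.closedBall 0 (2 * R) with hB
  have hAm : MeasurableSet A := Metric.isClosed_closedBall.measurableSet
  have hBm : MeasurableSet B := Metric.isClosed_closedBall.measurableSet
  have mem_B : ∀ {c : ℝ} {t y : E}, |c| ≤ 1 → t ∈ A → y ∈ A → t + c • y ∈ B := by
    intro c t y hc ht hy
    rw [hA, mem_closedBall_zero_iff] at ht hy
    rw [hB, mem_closedBall_zero_iff]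
    have h₁ := norm_add_le t (c • y)
    have h₂ : ‖c • y‖ ≤ ‖y‖ := by
      rw [norm_smul, Real.norm_eq_abs]
      exact mul_le_of_le_one_left (norm_nonneg y) hc
    linarith
  set φB : E → ℝ≥0∞ := B.indicator fun t ↦ φ (z + t)
  set ψB : E → ℝ≥0∞ := B.indicator fun t ↦ ψ (z + t)
  have hφB : Measurable φB := Measurable.indicator (by fun_prop) hBm
  have hψB : Measurable ψB := Measurable.indicator (by fun_prop) hBm
  calc ∫⁻ t in A, lbilinAvg μ A θ φ ψ (z + t) ∂μ
      ≤ ∫⁻ t in A, lbilinAvg μ A θ φB ψB t ∂μ := by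
        refine setLIntegral_mono' hAm fun t ht ↦ setLIntegral_mono' hAm fun y hy ↦ ?_
        have h₁ : t + (θ - 1) • y ∈ B :=
          mem_B (abs_le.2 ⟨by linarith [hθ.1], by linarith [hθ.2]⟩) ht hy
        have h₂ : t + θ • y ∈ B := mem_B (abs_le.2 ⟨by linarith [hθ.1], hθ.2⟩) ht hy
        simp only [φB, ψB, indicator_of_mem h₁, indicator_of_mem h₂, add_assoc, le_refl]
    _ ≤ ∫⁻ t, lbilinAvg μ A θ φB ψB t ∂μ := setLIntegral_le_lintegral _ _
    _ = ∫⁻ y in A, ∫⁻ x, φB (x - y) * ψB x ∂μ ∂μ := lintegral_lbilinAvg μ A θ hφB hψB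
    _ ≤ ∫⁻ y, ∫⁻ x, φB (x - y) * ψB x ∂μ ∂μ := setLIntegral_le_lintegral _ _
    _ = ∫⁻ x, ∫⁻ y, φB (x - y) * ψB x ∂μ ∂μ := lintegral_lintegral_swap (by fun_prop)
    _ = ∫⁻ x, (∫⁻ y, φB y ∂μ) * ψB x ∂μ := by
        refine lintegral_congr fun x ↦ ?_
        rw [lintegral_mul_const _ (by fun_prop), lintegral_sub_left_eq_self φB x]
    _ = (∫⁻ y, φB y ∂μ) * ∫⁻ x, ψB x ∂μ := lintegral_const_mul _ hψB
    _ = _ := by rw [lintegral_indicator hBm, lintegral_indicator hBm]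

/-- The `L^p × L^1 → L^s` bound for `1 / s = 1 / p + 1`, `1 ≤ p < ∞`. -/
theorem lintegral_lbilinAvg_rpow_le {R : ℝ} (hR : 0 < R) {θ : ℝ} (hθ : θ ∈ Icc (0 : ℝ) 1)
    {p s : ℝ} (hp : 1 ≤ p) (hs : 0 < s) (hps : 1 / s = 1 / p + 1)
    {φ ψ : E → ℝ≥0∞} (hφ : Measurable φ) (hψ : Measurable ψ) :
    (∫⁻ x, lbilinAvg μ (Metric.closedBall 0 R) θ φ ψ x ^ s ∂μ) ^ (1 / s) ≤
      (μ (Metric.closedBall 0 R))⁻¹ * μ (Metric.closedBall 0 (2 * R)) ^ 2 *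
        (∫⁻ x, φ x ^ p ∂μ) ^ (1 / p) * ∫⁻ x, ψ x ∂μ := by
  have := FiniteDimensional.proper ℝ E
  have hp0 : 0 < p := by linarith
  have hs1 : s ≤ 1 := by
    rw [← one_div_le_one_div one_pos hs, hps, one_div_one]
    linarith [one_div_pos.2 hp0]
  set A : Set E := Metric.closedBall 0 R
  set B : Set E := Metric.closedBall 0 (2 * R)
  have ha0 : μ A ≠ 0 := (Metric.measure_closedBall_pos μ 0 hR).ne'
  have hat : μ A ≠ ∞ := (isCompact_closedBall 0 R).measure_lt_top.ne
  set J := lbilinAvg μ A θ φ ψ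
  have hJ : Measurable J := measurable_lbilinAvg μ A θ hφ hψ
  set F : E → ℝ≥0∞ := fun z ↦ ∫⁻ t in B, φ (z + t) ∂μ
  set G : E → ℝ≥0∞ := fun z ↦ ∫⁻ t in B, ψ (z + t) ∂μ
  have hF : Measurable F := measurable_setLIntegral_add μ B hφ
  have hG : Measurable G := measurable_setLIntegral_add μ B hψ
  have hFp : (∫⁻ z, F z ^ p ∂μ) ^ (1 / p) ≤ μ B * (∫⁻ x, φ x ^ p ∂μ) ^ (1 / p) := by
    rw [one_div, ENNReal.rpow_inv_le_iff hp0, ENNReal.mul_rpow_of_nonneg _ _ hp0.le,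
      ENNReal.rpow_inv_rpow hp0.ne']
    calc ∫⁻ z, F z ^ p ∂μ ≤ ∫⁻ z, μ B ^ (p - 1) * ∫⁻ t in B, φ (z + t) ^ p ∂μ ∂μ := by
          refine lintegral_mono fun z ↦ ?_
          simpa using rpow_lintegral_le_measure_univ_rpow_mul (μ := μ.restrict B) hp
            (h := fun t ↦ φ (z + t)) (by fun_prop)
      _ = μ B ^ (p - 1) * (μ B * ∫⁻ x, φ x ^ p ∂μ) := by
          rw [lintegral_const_mul _ (measurable_setLIntegral_add μ B (hφ.pow_const p)),
            lintegral_setLIntegral_add μ B (hφ.pow_const p)]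
      _ = μ B ^ p * ∫⁻ x, φ x ^ p ∂μ := by
          rw [← mul_assoc]
          congr 1
          nth_rewrite 2 [← ENNReal.rpow_one (μ B)]
          rw [← ENNReal.rpow_add_of_nonneg _ _ (by linarith) zero_le_one, sub_add_cancel]
  have hmain : μ A * ∫⁻ x, J x ^ s ∂μ ≤
      μ A ^ (1 - s) * (μ B * (∫⁻ x, φ x ^ p ∂μ) ^ (1 / p) * (μ B * ∫⁻ x, ψ x ∂μ)) ^ s := by
    calc μ A * ∫⁻ x, J x ^ s ∂μ = ∫⁻ z, ∫⁻ t in A, J (z + t) ^ s ∂μ ∂μ :=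
          (lintegral_setLIntegral_add μ A (hJ.pow_const s)).symm
      _ ≤ ∫⁻ z, μ A ^ (1 - s) * (F z * G z) ^ s ∂μ := by
          refine lintegral_mono fun z ↦ ?_
          refine (lintegral_rpow_le_measure_univ_rpow_mul (μ := μ.restrict A) hs hs1
            (h := fun t ↦ J (z + t)) (by fun_prop)).trans ?_
          rw [Measure.restrict_apply_univ]
          gcongr
          exact setLIntegral_lbilinAvg_closedBall_le μ hθ hφ hψ z
      _ = μ A ^ (1 - s) * ∫⁻ z, (F z * G z) ^ s ∂μ := lintegral_const_mul _ (by fun_prop)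
      _ ≤ μ A ^ (1 - s) * ((∫⁻ z, F z ^ p ∂μ) ^ (1 / p) * ∫⁻ z, G z ∂μ) ^ s := by
          gcongr
          exact lintegral_mul_rpow_le_Lp_mul_L1 hp0 hs hps hF hG
      _ ≤ _ := by
          gcongr
          exact (lintegral_setLIntegral_add μ B hψ).le
  rw [one_div, ENNReal.rpow_inv_le_iff hs]
  rw [ENNReal.rpow_sub _ _ ha0 hat, ENNReal.rpow_one, div_eq_mul_inv, mul_assoc,
    ENNReal.mul_le_mul_iff_right ha0 hat, ← ENNReal.inv_rpow,
    ← ENNReal.mul_rpow_of_nonneg _ _ hs.le] at hmain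
  refine hmain.trans_eq ?_
  congr 1
  ring

theorem inv_measure_closedBall_mul_sq {R : ℝ} (hR : 0 < R) :
    (μ (Metric.closedBall (0 : E) R))⁻¹ * μ (Metric.closedBall (0 : E) (2 * R)) ^ 2 =
      4 ^ Module.finrank ℝ E * μ (Metric.closedBall (0 : E) R) := by
  have := FiniteDimensional.proper ℝ E
  have ha0 : μ (Metric.closedBall (0 : E) R) ≠ 0 := (Metric.measure_closedBall_pos μ 0 hR).ne'
  have hat : μ (Metric.closedBall (0 : E) R) ≠ ∞ := (isCompact_closedBall 0 R).measure_lt_top.ne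
  rw [Measure.addHaar_closedBall_mul_of_pos μ 0 two_pos, mul_pow, sq (μ _), mul_left_comm,
    ← mul_assoc (μ _)⁻¹, ENNReal.inv_mul_cancel ha0 hat, one_mul,
    ENNReal.ofReal_pow zero_le_two, ← pow_mul, mul_comm _ 2, pow_mul]
  norm_num

end BilinearAverage

theorem enorm_Ij_le (d : ℕ) (θ : ℝ) (j : ℤ) (f g : EuclideanSpace ℝ (Fin d) → ℝ)
    (x : EuclideanSpace ℝ (Fin d)) :
    ‖Ij d θ j f g x‖ₑ ≤
      lbilinAvg volume (Metric.closedBall 0 (2 ^ j)) θ (‖f ·‖ₑ) (‖g ·‖ₑ) x := by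
  have hset : {y : EuclideanSpace ℝ (Fin d) | ‖y‖ ≤ 2 ^ j} = Metric.closedBall 0 (2 ^ j) := by
    ext y
    simp
  unfold Ij
  rw [hset]
  refine (enorm_integral_le_lintegral_enorm _).trans_eq ?_
  simp only [enorm_mul, lbilinAvg]

/-- `‖I_j^θ(f,g)‖_{L^{p/(p+1)}} ≤ c 2^{dj} ‖f‖_{L^p} ‖g‖_{L^1}` for `1 ≤ p ≤ ∞`,
with `c = c(d,p)` independent of `θ` and `j`.  The exponent `s = p/(p+1)` is
encoded by `1/s = 1/p + 1`. -/
theorem Ij_mixed_bound_right (d : ℕ) (hd : 0 < d) (p s : ℝ≥0∞) (hp : 1 ≤ p)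
    (hs : 1 / s = 1 / p + 1) :
    ∃ c : ℝ, 0 < c ∧ ∀ θ : ℝ, θ ∈ Set.Icc (0 : ℝ) 1 → ∀ j : ℤ,
      ∀ f g : EuclideanSpace ℝ (Fin d) → ℝ, Measurable f → Measurable g →
        0 ≤ f → 0 ≤ g →
        eLpNorm (Ij d θ j f g) s volume ≤
          ENNReal.ofReal (c * 2 ^ ((d : ℤ) * j)) * eLpNorm f p volume * eLpNorm g 1 volume := by
  set E := EuclideanSpace ℝ (Fin d)
  have hV0 : 0 < volume.real (Metric.closedBall (0 : E) 1) :=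
    ENNReal.toReal_pos (Metric.measure_closedBall_pos volume _ one_pos).ne'
      (isCompact_closedBall _ _).measure_lt_top.ne
  refine ⟨4 ^ d * volume.real (Metric.closedBall (0 : E) 1), by positivity, ?_⟩
  intro θ hθ j f g hf hg _ _
  have hR : (0 : ℝ) < 2 ^ j := by positivity
  have hconst : ENNReal.ofReal
      (4 ^ d * volume.real (Metric.closedBall (0 : E) 1) * 2 ^ ((d : ℤ) * j)) =
      4 ^ d * volume (Metric.closedBall (0 : E) (2 ^ j)) := by
    rw [Measure.addHaar_closedBall' volume _ hR.le, finrank_euclideanSpace_fin,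
      mul_right_comm, mul_assoc, ENNReal.ofReal_mul (by positivity),
      ENNReal.ofReal_mul (by positivity), Measure.real, ENNReal.ofReal_toReal
      (isCompact_closedBall _ _).measure_lt_top.ne, ENNReal.ofReal_pow (by norm_num),
      mul_comm (d : ℤ) j, zpow_mul, zpow_natCast]
    norm_num
  rw [hconst]
  have hs0 : s ≠ 0 := by
    rintro rfl
    have : 1 / p ≤ 1 := by simpa using hp
    rw [ENNReal.div_zero one_ne_zero] at hs
    exact (ENNReal.add_lt_top.2 ⟨this.trans_lt ENNReal.one_lt_top, ENNReal.one_lt_top⟩).ne hs.symm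
  have hst : s ≠ ∞ := by
    rintro rfl
    rw [ENNReal.div_top] at hs
    exact one_ne_zero (add_eq_zero.1 hs.symm).2
  set φ : E → ℝ≥0∞ := (‖f ·‖ₑ)
  set ψ : E → ℝ≥0∞ := (‖g ·‖ₑ)
  have hφ : Measurable φ := hf.enorm
  have hψ : Measurable ψ := hg.enorm
  rw [eLpNorm_one_eq_lintegral_enorm (f := g)]
  rcases eq_or_ne p ∞ with rfl | hpt
  · obtain rfl : s = 1 := by simpa using hs
    rw [eLpNorm_one_eq_lintegral_enorm, eLpNorm_exponent_top]
    calc ∫⁻ x, ‖Ij d θ j f g x‖ₑ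
        ≤ ∫⁻ x, lbilinAvg volume (Metric.closedBall 0 (2 ^ j)) θ φ ψ x :=
          lintegral_mono (enorm_Ij_le d θ j f g)
      _ ≤ volume (Metric.closedBall (0 : E) (2 ^ j)) * eLpNormEssSup f volume * ∫⁻ x, ψ x :=
          lintegral_lbilinAvg_le volume _ θ hφ hψ ae_le_eLpNormEssSup
      _ ≤ _ := by
          gcongr
          exact le_mul_of_one_le_left' (one_le_pow₀ (by norm_num))
  · have hp0 : p ≠ 0 := (one_pos.trans_le hp).ne'
    have hs' : 0 < s.toReal := ENNReal.toReal_pos hs0 hst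
    have hps : 1 / s.toReal = 1 / p.toReal + 1 := by
      have := congrArg ENNReal.toReal hs
      rwa [ENNReal.toReal_add (by simp [hp0]) ENNReal.one_ne_top, ENNReal.toReal_div,
        ENNReal.toReal_div, ENNReal.toReal_one] at this
    have hp1 : 1 ≤ p.toReal := by
      simpa using ENNReal.toReal_mono hpt hp
    rw [eLpNorm_eq_lintegral_rpow_enorm_toReal hs0 hst,
      eLpNorm_eq_lintegral_rpow_enorm_toReal hp0 hpt]
    calc (∫⁻ x, ‖Ij d θ j f g x‖ₑ ^ s.toReal) ^ (1 / s.toReal)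
        ≤ (∫⁻ x, lbilinAvg volume (Metric.closedBall 0 (2 ^ j)) θ φ ψ x ^ s.toReal) ^
            (1 / s.toReal) := by
          gcongr with x
          exact enorm_Ij_le d θ j f g x
      _ ≤ _ := lintegral_lbilinAvg_rpow_le volume hR hθ hp1 hs' hps hφ hψ
      _ = _ := by
          rw [inv_measure_closedBall_mul_sq volume hR, finrank_euclideanSpace_fin]
end

section
/- Let d ∈ ℕ, 0 < α < d, 1 < p ≤ d/α, θ ∈ [0,1], j ∈ ℤ, and let A, B, E ⊆ ℝ^d be measurable sets of finite Lebesgue measure. Then there exists a constant C = C(α, d, p) > 0, independent of θ and j, such that ∫_E I_j^θ(χ_A, χ_B)(x) dx ≤ C · 2^{dj(1 − αp/d)} · min{2^{αpj} |E|, |A| |B|^{αp/d}}. -/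
open MeasureTheory Set
open scoped ENNReal NNReal

theorem ofReal_Ij_indicator_le (d : ℕ) (θ : ℝ) (j : ℤ) (A B : Set (EuclideanSpace ℝ (Fin d)))
    (x : EuclideanSpace ℝ (Fin d)) :
    ENNReal.ofReal (Ij d θ j (A.indicator 1) (B.indicator 1) x) ≤
      ∫⁻ y in Metric.closedBall (0 : EuclideanSpace ℝ (Fin d)) (2 ^ j),
        A.indicator (1 : EuclideanSpace ℝ (Fin d) → ℝ≥0∞) (x + (θ - 1) • y) * B.indicator 1 (x + θ • y) := by
  have hK : {y : EuclideanSpace ℝ (Fin d) | ‖y‖ ≤ 2 ^ j} = Metric.closedBall 0 (2 ^ j) := by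
    ext y; simp
  refine (Real.ofReal_le_enorm _).trans ?_
  rw [Ij, hK]
  refine (enorm_integral_le_lintegral_enorm _).trans (lintegral_mono fun y => ?_)
  by_cases hA : x + (θ - 1) • y ∈ A <;> by_cases hB : x + θ • y ∈ B <;> simp [hA, hB]

/-- Shearing the double integral by `x ↦ x + (θ - 1) • y` removes the dependence on `θ`. -/
theorem lintegral_lintegral_shear {d : ℕ} (θ : ℝ) (K : Set (EuclideanSpace ℝ (Fin d)))
    {f g : EuclideanSpace ℝ (Fin d) → ℝ≥0∞} (hf : Measurable f) (hg : Measurable g) :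
    ∫⁻ x, ∫⁻ y in K, f (x + (θ - 1) • y) * g (x + θ • y) =
      ∫⁻ x, f x * ∫⁻ y in K, g (x + y) := by
  rw [lintegral_lintegral_swap (by fun_prop)]
  have h (y : EuclideanSpace ℝ (Fin d)) :
      ∫⁻ x, f (x + (θ - 1) • y) * g (x + θ • y) = ∫⁻ x, f x * g (x + y) := by
    rw [← lintegral_add_right_eq_self (fun x => f x * g (x + y)) ((θ - 1) • y)]
    congr! 4 with x
    module
  simp_rw [h]
  rw [lintegral_lintegral_swap (by fun_prop)]
  congr! 2 with x
  exact lintegral_const_mul _ (by fun_prop)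

theorem setLIntegral_indicator_one_add_le_min {d : ℕ} (K : Set (EuclideanSpace ℝ (Fin d)))
    {B : Set (EuclideanSpace ℝ (Fin d))} (hB : MeasurableSet B) (x : EuclideanSpace ℝ (Fin d)) :
    ∫⁻ y in K, B.indicator (1 : EuclideanSpace ℝ (Fin d) → ℝ≥0∞) (x + y) ≤ min (volume B) (volume K) := by
  refine le_min ?_ ?_
  · refine (setLIntegral_le_lintegral _ _).trans ?_
    rw [lintegral_add_left_eq_self, lintegral_indicator_one hB]
  · calc ∫⁻ y in K, B.indicator (1 : EuclideanSpace ℝ (Fin d) → ℝ≥0∞) (x + y)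
        ≤ ∫⁻ _ in K, (1 : ℝ≥0∞) :=
          lintegral_mono fun y => Set.indicator_apply_le' (by simp) (by simp)
      _ = volume K := by simp

theorem lintegral_Ij_indicator_le {d : ℕ} (θ : ℝ) (j : ℤ)
    {A B : Set (EuclideanSpace ℝ (Fin d))} (hA : MeasurableSet A) (hB : MeasurableSet B) :
    ∫⁻ x, ENNReal.ofReal (Ij d θ j (A.indicator 1) (B.indicator 1) x) ≤
      volume A * min (volume B)
        (volume (Metric.closedBall (0 : EuclideanSpace ℝ (Fin d)) (2 ^ j))) := by
  refine (lintegral_mono fun x => ofReal_Ij_indicator_le d θ j A B x).trans ?_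
  rw [lintegral_lintegral_shear θ _ (measurable_one.indicator hA) (measurable_one.indicator hB)]
  refine (lintegral_mono fun x => mul_le_mul_right
    (setLIntegral_indicator_one_add_le_min _ hB x) _).trans ?_
  rw [lintegral_mul_const _ (measurable_one.indicator hA), lintegral_indicator_one hA]

theorem setLIntegral_Ij_indicator_le {d : ℕ} (θ : ℝ) (j : ℤ)
    (A B E : Set (EuclideanSpace ℝ (Fin d))) :
    ∫⁻ x in E, ENNReal.ofReal (Ij d θ j (A.indicator 1) (B.indicator 1) x) ≤
      volume (Metric.closedBall (0 : EuclideanSpace ℝ (Fin d)) (2 ^ j)) * volume E := by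
  rw [← setLIntegral_const]
  refine lintegral_mono fun x => (ofReal_Ij_indicator_le d θ j A B x).trans ?_
  calc ∫⁻ y in Metric.closedBall (0 : EuclideanSpace ℝ (Fin d)) (2 ^ j),
        A.indicator (1 : EuclideanSpace ℝ (Fin d) → ℝ≥0∞) (x + (θ - 1) • y) *
          B.indicator 1 (x + θ • y)
      ≤ ∫⁻ _ in Metric.closedBall (0 : EuclideanSpace ℝ (Fin d)) (2 ^ j), (1 : ℝ≥0∞) :=
        lintegral_mono fun y => mul_le_one'
          (Set.indicator_apply_le' (by simp) (by simp)) (Set.indicator_apply_le' (by simp) (by simp))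
    _ = volume (Metric.closedBall (0 : EuclideanSpace ℝ (Fin d)) (2 ^ j)) := by simp

theorem min_le_rpow_mul_rpow_one_sub {b k s : ℝ} (hb : 0 ≤ b) (hk : 0 ≤ k) (hs : 0 ≤ s)
    (hs1 : s ≤ 1) : min b k ≤ b ^ s * k ^ (1 - s) := by
  have hm : 0 ≤ min b k := le_min hb hk
  calc min b k = min b k ^ s * min b k ^ (1 - s) := by
        rw [← Real.rpow_add_of_nonneg hm hs (sub_nonneg.2 hs1)]; simp
    _ ≤ b ^ s * k ^ (1 - s) := by
        have := sub_nonneg.2 hs1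
        gcongr
        · exact min_le_left _ _
        · exact min_le_right _ _

/-- Restricted bound for the truncated operator:
`∫_E I_j^θ(χ_A, χ_B) ≤ C 2^{dj(1 - αp/d)} min{2^{αpj}|E|, |A||B|^{αp/d}}`
for `1 < p ≤ d/α`, with `C = C(α,d,p)` independent of `θ` and `j`. -/
theorem Ij_restricted_bound (d : ℕ) (hd : 0 < d) (α p : ℝ) (hα : 0 < α) (hαd : α < d)
    (hp : 1 < p) (hpd : p ≤ d / α) :
    ∃ C : ℝ, 0 < C ∧ ∀ θ : ℝ, θ ∈ Set.Icc (0 : ℝ) 1 → ∀ j : ℤ,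
      ∀ A B E : Set (EuclideanSpace ℝ (Fin d)),
        MeasurableSet A → MeasurableSet B → MeasurableSet E →
        volume A < ⊤ → volume B < ⊤ → volume E < ⊤ →
        (∫⁻ x in E, ENNReal.ofReal (Ij d θ j (A.indicator 1) (B.indicator 1) x)) ≤
          ENNReal.ofReal (C * (2 : ℝ) ^ ((d : ℝ) * j * (1 - α * p / d)) *
            min ((2 : ℝ) ^ (α * p * j) * (volume E).toReal)
              ((volume A).toReal * (volume B).toReal ^ (α * p / d))) := by
  have hd0 : (0 : ℝ) < d := by exact_mod_cast hd
  set s : ℝ := α * p / d with hs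
  have hs0 : 0 ≤ s := by positivity
  have hs1 : s ≤ 1 := by
    rw [hs, div_le_one hd0, mul_comm]
    exact (le_div_iff₀ hα).1 hpd
  set v : ℝ := (volume (Metric.ball (0 : EuclideanSpace ℝ (Fin d)) 1)).toReal with hv
  have hv0 : 0 ≤ v := ENNReal.toReal_nonneg
  refine ⟨v + 1, by positivity, fun θ _ j A B E hA hB _ hAf hBf hEf => ?_⟩
  set k := volume (Metric.closedBall (0 : EuclideanSpace ℝ (Fin d)) (2 ^ j)) with hk
  have hkf : k ≠ ⊤ := measure_closedBall_lt_top.ne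
  have hk_eq : k.toReal = (2 : ℝ) ^ ((d : ℝ) * j) * v := by
    rw [hk, Measure.addHaar_closedBall _ _ (by positivity), ENNReal.toReal_mul,
      ENNReal.toReal_ofReal (by positivity), finrank_euclideanSpace_fin, mul_comm (d : ℝ),
      Real.rpow_mul (by norm_num), Real.rpow_intCast, Real.rpow_natCast]
  have h2 : (0 : ℝ) < (2 : ℝ) ^ ((d : ℝ) * j * (1 - s)) := by positivity
  rw [mul_min_of_nonneg _ _ (by positivity), ENNReal.ofReal_min]
  refine le_min ?_ ?_
  · refine (setLIntegral_Ij_indicator_le θ j A B E).trans ?_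
    rw [ENNReal.le_ofReal_iff_toReal_le (ENNReal.mul_ne_top hkf hEf.ne) (by positivity),
      ENNReal.toReal_mul, hk_eq]
    have hpow : (2 : ℝ) ^ ((d : ℝ) * j) =
        (2 : ℝ) ^ ((d : ℝ) * j * (1 - s)) * (2 : ℝ) ^ (α * p * j) := by
      rw [← Real.rpow_add (by norm_num)]
      congr 1
      rw [hs]
      field_simp
      ring
    calc _ = v * ((2 : ℝ) ^ ((d : ℝ) * j) * (volume E).toReal) := by ring
      _ ≤ (v + 1) * ((2 : ℝ) ^ ((d : ℝ) * j) * (volume E).toReal) := by gcongr; linarith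
      _ = _ := by rw [hpow]; ring
  · refine (setLIntegral_le_lintegral _ _).trans ((lintegral_Ij_indicator_le θ j hA hB).trans ?_)
    have hmf : min (volume B) k ≠ ⊤ := ((min_le_left _ _).trans_lt hBf).ne
    rw [ENNReal.le_ofReal_iff_toReal_le (ENNReal.mul_ne_top hAf.ne hmf) (by positivity),
      ENNReal.toReal_mul, ENNReal.toReal_min hBf.ne hkf]
    have hvs : v ^ (1 - s) ≤ v + 1 :=
      calc v ^ (1 - s) ≤ (v + 1) ^ (1 - s) := by gcongr; linarith
        _ ≤ (v + 1) ^ (1 : ℝ) := Real.rpow_le_rpow_of_exponent_le (by linarith) (by linarith)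
        _ = v + 1 := Real.rpow_one _
    calc _ ≤ (volume A).toReal * ((volume B).toReal ^ s * k.toReal ^ (1 - s)) := by
          gcongr
          exact min_le_rpow_mul_rpow_one_sub ENNReal.toReal_nonneg ENNReal.toReal_nonneg hs0 hs1
      _ = v ^ (1 - s) * (2 : ℝ) ^ ((d : ℝ) * j * (1 - s)) *
          ((volume A).toReal * (volume B).toReal ^ s) := by
          rw [hk_eq, Real.mul_rpow (by positivity) hv0, ← Real.rpow_mul (by norm_num)]
          ring
      _ ≤ _ := by gcongr
end
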